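/- Let q ∈ (0,1), β ∈ ℝ, n,p ∈ ℕ with p < n, and let ω be a convex upwards (concave) modulus of continuity. There exists an absolute constant C > 0 (independent of n, p, q, ω and β) such that whenever n − p ≥ 6/(1−q), one has | E(C^q_β H_ω; V_{n,p}) − (q^{n−p+1}/p) · (K_{p,q}/π²) · e_{n−p+1}(ω) | ≤ C · (q^{n−p+1}/p) · ω(π) / ((1−q)^{δ(p)} (n−p+1)), where e_{m}(ω) = ∫₀^{π/2} ω(2t/m) sin t dt, K_{p,q} = ∫₀^{2π} √(1 − 2q^p cos(pt) + q^{2p}) / (1 − 2q cos t + q²) dt, and δ(p) = 2 if p = 1 and δ(p) = 3 if p ≥ 2. -/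

import Mathlib

open Real MeasureTheory intervalIntegral

noncomputable section

/-- A modulus of continuity: continuous, nondecreasing, subadditive on `[0,∞)`, vanishing at 0. -/
def IsModulus (ω : ℝ → ℝ) : Prop :=
  ContinuousOn ω (Set.Ici 0) ∧ MonotoneOn ω (Set.Ici 0) ∧
    (∀ s t : ℝ, 0 ≤ s → 0 ≤ t → ω (s + t) ≤ ω s + ω t) ∧ ω 0 = 0

/-- A convex upwards (i.e. concave) modulus of continuity. -/
def IsConcaveModulus (ω : ℝ → ℝ) : Prop :=
  IsModulus ω ∧ ConcaveOn ℝ (Set.Ici 0) ω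

/-- The class `H_ω` of continuous `2π`-periodic functions with modulus of continuity `ω`. -/
def Hclass (ω : ℝ → ℝ) : Set (ℝ → ℝ) :=
  {φ | Continuous φ ∧ (∀ x, φ (x + 2 * π) = φ x) ∧ ∀ s t : ℝ, |φ s - φ t| ≤ ω |s - t|}

/-- The Poisson kernel `P_{q,β}(t) = Σ_{k≥1} q^k cos(kt + βπ/2)`. -/
def Pker (q β t : ℝ) : ℝ :=
  ∑' k : ℕ, q ^ (k + 1) * Real.cos ((k + 1 : ℕ) * t + β * π / 2)

/-- The class `C^q_β H_ω` of Poisson integrals of functions from `H_ω`. -/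
def CqbH (q β : ℝ) (ω : ℝ → ℝ) : Set (ℝ → ℝ) :=
  {f | ∃ A₀ : ℝ, ∃ φ ∈ Hclass ω,
      f = fun x => A₀ + (1 / π) * ∫ t in (0:ℝ)..(2 * π), φ (x + t) * Pker q β t}

/-- Fourier cosine coefficient. -/
def coefA (f : ℝ → ℝ) (j : ℕ) : ℝ := (1 / π) * ∫ t in (0:ℝ)..(2 * π), f t * Real.cos (j * t)

/-- Fourier sine coefficient. -/
def coefB (f : ℝ → ℝ) (j : ℕ) : ℝ := (1 / π) * ∫ t in (0:ℝ)..(2 * π), f t * Real.sin (j * t)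

/-- The `k`-th partial sum of the Fourier series of `f`. -/
def Ssum (f : ℝ → ℝ) (k : ℕ) (x : ℝ) : ℝ :=
  coefA f 0 / 2 +
    ∑ j ∈ Finset.Icc 1 k, (coefA f j * Real.cos (j * x) + coefB f j * Real.sin (j * x))

/-- The de la Vallée Poussin sum `V_{n,p}(f;x) = (1/p) Σ_{k=n-p}^{n-1} S_k(f;x)`. -/
def Vsum (n p : ℕ) (f : ℝ → ℝ) (x : ℝ) : ℝ :=
  (1 / (p : ℝ)) * ∑ k ∈ Finset.Ico (n - p) n, Ssum f k x

/-- `E(N; A) = sup_{f ∈ N} ‖f - A f‖_C`. -/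
def Edev (N : Set (ℝ → ℝ)) (A : (ℝ → ℝ) → ℝ → ℝ) : ℝ :=
  ⨆ f : N, ⨆ x : ℝ, |(f : ℝ → ℝ) x - A f x|

/-- The constant `K_{p,q}`. -/
def Kpq (p : ℕ) (q : ℝ) : ℝ :=
  ∫ t in (0:ℝ)..(2 * π),
    Real.sqrt (1 - 2 * q ^ p * Real.cos (p * t) + q ^ (2 * p)) /
      (1 - 2 * q * Real.cos t + q ^ 2)

/-- `e_m(ω) = ∫₀^{π/2} ω(2t/m) sin t dt`. -/
def eInt (m : ℕ) (ω : ℝ → ℝ) : ℝ := ∫ t in (0:ℝ)..(π / 2), ω (2 * t / m) * Real.sin t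

/-- `δ(p) = 2` if `p = 1`, `δ(p) = 3` otherwise. -/
def δp (p : ℕ) : ℕ := if p = 1 then 2 else 3

/-- `Z_r(u) = 1/√(1 - 2r cos u + r²)`. -/
def Zf (r u : ℝ) : ℝ := 1 / Real.sqrt (1 - 2 * r * Real.cos u + r ^ 2)

/-- `θ_r(u) = arctan(r sin u / (1 - r cos u))`. -/
def θf (r u : ℝ) : ℝ := Real.arctan (r * Real.sin u / (1 - r * Real.cos u))

/-- The complete elliptic integral of the first kind. -/
def ellK (r : ℝ) : ℝ := ∫ t in (0:ℝ)..(π / 2), 1 / Real.sqrt (1 - r ^ 2 * Real.sin t ^ 2)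

/-- `α_q = ⌊3q/(1-q)⌋ + 2`. -/
def αq (q : ℝ) : ℕ := ⌊3 * q / (1 - q)⌋₊ + 2

lemma om_conc {ω : ℝ → ℝ} (h : IsConcaveModulus ω) {x y a b : ℝ} (hx : 0 ≤ x) (hy : 0 ≤ y)
    (ha : 0 ≤ a) (hb : 0 ≤ b) (hab : a + b = 1) : a * ω x + b * ω y ≤ ω (a * x + b * y) := by
  have := h.2.2 (Set.mem_Ici.2 hx) (Set.mem_Ici.2 hy) ha hb hab
  simpa only [smul_eq_mul] using this

lemma om_nonneg {ω : ℝ → ℝ} (h : IsConcaveModulus ω) {x : ℝ} (hx : 0 ≤ x) : 0 ≤ ω x := by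
  have := h.1.2.1 (Set.mem_Ici.2 le_rfl) (Set.mem_Ici.2 hx) hx
  rwa [h.1.2.2.2] at this

lemma om_mono {ω : ℝ → ℝ} (h : IsConcaveModulus ω) {x y : ℝ} (hx : 0 ≤ x) (hxy : x ≤ y) :
    ω x ≤ ω y := h.1.2.1 (Set.mem_Ici.2 hx) (Set.mem_Ici.2 (hx.trans hxy)) hxy

lemma om_scale {ω : ℝ → ℝ} (h : IsConcaveModulus ω) {l x : ℝ} (hl : 1 ≤ l) (hx : 0 ≤ x) :
    ω (l * x) ≤ l * ω x := by
  have hl0 : 0 < l := by linarith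
  have h1 : 0 ≤ 1 - 1 / l := by
    have : 1 / l ≤ 1 := by rw [div_le_one hl0]; exact hl
    linarith
  have := om_conc h (x := l * x) (by positivity) (y := 0) le_rfl
    (a := 1 / l) (b := 1 - 1 / l) (by positivity) h1 (by ring)
  simp only [h.1.2.2.2, mul_zero, add_zero] at this
  have e : 1 / l * (l * x) = x := by field_simp
  rw [e] at this
  calc ω (l * x) = l * (1 / l * ω (l * x)) := by field_simp
    _ ≤ _ := by gcongr

lemma om_mid {ω : ℝ → ℝ} (h : IsConcaveModulus ω) {a b : ℝ} (ha : 0 ≤ a) (hb : 0 ≤ b) :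
    ω (2 * a) / 2 + ω (2 * b) / 2 ≤ ω (a + b) := by
  have := om_conc h (x := 2 * a) (by positivity) (y := 2 * b)
    (by positivity)
    (a := 1 / 2) (b := 1 / 2) (by positivity) (by positivity) (by norm_num)
  have e : 1 / 2 * (2 * a) + 1 / 2 * (2 * b) = a + b := by ring
  rw [e] at this
  linarith

lemma cont_of_mod {ω : ℝ → ℝ} (h : IsConcaveModulus ω) {φ : ℝ → ℝ}
    (hφ : ∀ s t : ℝ, |φ s - φ t| ≤ ω |s - t|) : Continuous φ := by
  rw [continuous_iff_continuousAt]
  intro x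
  have hc : Filter.Tendsto ω (nhdsWithin 0 (Set.Ici 0)) (nhds 0) := by
    have := h.1.1 0 (Set.mem_Ici.2 le_rfl)
    unfold ContinuousWithinAt at this
    rwa [h.1.2.2.2] at this
  have h2 : Filter.Tendsto (fun s => |s - x|) (nhds x) (nhdsWithin 0 (Set.Ici 0)) := by
    apply tendsto_nhdsWithin_of_tendsto_nhds_of_eventually_within
    · have : Continuous (fun s : ℝ => |s - x|) := by fun_prop
      have := this.tendsto x
      simpa using this
    · exact Filter.Eventually.of_forall fun s => Set.mem_Ici.2 (abs_nonneg _)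
  have h3 := hc.comp h2
  rw [ContinuousAt, tendsto_iff_dist_tendsto_zero]
  refine squeeze_zero (fun _ => dist_nonneg) (fun s => ?_) h3
  rw [Real.dist_eq]
  exact hφ s x

lemma om_comp_cont {ω : ℝ → ℝ} (h : IsConcaveModulus ω) {f : ℝ → ℝ} (hf : Continuous f) :
    Continuous (fun u => ω |f u|) :=
  h.1.1.comp_continuous (by fun_prop) (fun u => Set.mem_Ici.2 (abs_nonneg _))

lemma eInt_eq {ω : ℝ → ℝ} (m : ℕ) :
    eInt m ω = ∫ t in (0:ℝ)..(π / 2), ω |2 * t / m| * Real.sin t := by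
  unfold eInt
  apply intervalIntegral.integral_congr
  intro t ht
  rw [Set.uIcc_of_le (by positivity)] at ht
  have : 0 ≤ 2 * t / m := by have := ht.1; positivity
  simp only [abs_of_nonneg this]

lemma sin_half_int : ∫ t in (0:ℝ)..(π / 2), Real.sin t = 1 := by
  rw [integral_sin]; simp

lemma eInt_nonneg {ω : ℝ → ℝ} (h : IsConcaveModulus ω) (m : ℕ) : 0 ≤ eInt m ω := by
  unfold eInt
  apply intervalIntegral.integral_nonneg (by positivity)
  intro t ht
  have h0 := ht.1
  have := om_nonneg h (x := 2 * t / m) (by positivity)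
  have := Real.sin_nonneg_of_nonneg_of_le_pi h0 (by linarith [ht.2, Real.pi_pos])
  positivity

lemma eInt_le {ω : ℝ → ℝ} (h : IsConcaveModulus ω) {m : ℕ} (hm : 0 < m) : eInt m ω ≤ ω π := by
  have e : ω π = ∫ t in (0:ℝ)..(π / 2), ω π * Real.sin t := by
    rw [intervalIntegral.integral_const_mul, sin_half_int, mul_one]
  rw [e, eInt_eq]
  apply intervalIntegral.integral_mono_on (by positivity)
  · apply Continuous.intervalIntegrable
    exact (om_comp_cont h (by fun_prop)).mul Real.continuous_sin
  · apply Continuous.intervalIntegrable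
    fun_prop
  · intro t ht
    have h0 := ht.1
    have h1 : (1:ℝ) ≤ m := by exact_mod_cast hm
    have hs := Real.sin_nonneg_of_nonneg_of_le_pi h0 (by linarith [ht.2, Real.pi_pos])
    have hle : |2 * t / m| ≤ π := by
      rw [abs_of_nonneg (by positivity)]
      calc 2 * t / m ≤ 2 * t := div_le_self (by positivity) h1
        _ ≤ π := by linarith [ht.2]
    exact mul_le_mul_of_nonneg_right (om_mono h (abs_nonneg _) hle) hs

/-- periodic members of the class oscillate by at most `ω π` -/
lemma osc_le {ω : ℝ → ℝ} (h : IsConcaveModulus ω) {φ : ℝ → ℝ} (hφ : φ ∈ Hclass ω) (s t : ℝ) :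
    |φ s - φ t| ≤ ω π := by
  obtain ⟨-, hp, hm⟩ := hφ
  have hper : Function.Periodic φ (2 * π) := hp
  obtain ⟨y, hy, hys⟩ := hper.exists_mem_Ico (by positivity) s (t - π)
  rw [hys]
  refine (hm y t).trans (om_mono h (abs_nonneg _) ?_)
  rw [abs_le]
  constructor <;> linarith [hy.1, hy.2]

/-- triangle wave -/
def tri (s : ℝ) : ℝ := Real.arcsin (Real.cos s)

lemma tri_lip (s t : ℝ) : |tri s - tri t| ≤ |s - t| := by
  have b1 := Real.neg_pi_div_two_le_arcsin (Real.cos s)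
  have b2 := Real.arcsin_le_pi_div_two (Real.cos s)
  have b3 := Real.neg_pi_div_two_le_arcsin (Real.cos t)
  have b4 := Real.arcsin_le_pi_div_two (Real.cos t)
  have hpi : |tri s - tri t| ≤ π := by
    unfold tri; rw [abs_le]; constructor <;> linarith
  by_contra! hlt
  have hc : Real.cos |tri s - tri t| < Real.cos |s - t| :=
    Real.cos_lt_cos_of_nonneg_of_le_pi (abs_nonneg _) hpi hlt
  rw [Real.cos_abs, Real.cos_abs, Real.cos_sub, Real.cos_sub] at hc
  unfold tri at hc
  rw [Real.sin_arcsin (Real.neg_one_le_cos _) (Real.cos_le_one _),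
    Real.sin_arcsin (Real.neg_one_le_cos _) (Real.cos_le_one _),
    Real.cos_arcsin, Real.cos_arcsin, ← Real.abs_sin_eq_sqrt_one_sub_cos_sq,
    ← Real.abs_sin_eq_sqrt_one_sub_cos_sq, ← abs_mul] at hc
  linarith [le_abs_self (Real.sin s * Real.sin t)]

/-- odd extension of `ω (2 u / m) / 2` -/
def eta (ω : ℝ → ℝ) (m : ℝ) (u : ℝ) : ℝ := if 0 ≤ u then ω (2 * (u / m)) / 2 else
  -(ω (2 * (-u / m)) / 2)

lemma eta_neg {ω : ℝ → ℝ} (h : IsConcaveModulus ω) (m u : ℝ) : eta ω m (-u) = - eta ω m u := by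
  unfold eta
  rcases lt_trichotomy u 0 with hu | hu | hu
  · rw [if_pos (by linarith), if_neg (by linarith)]; simp
  · subst hu; simp [h.1.2.2.2]
  · rw [if_neg (by linarith), if_pos (by linarith)]; simp

lemma eta_diff_nonneg {ω : ℝ → ℝ} (h : IsConcaveModulus ω) {m : ℝ} (hm : 0 < m) {u v : ℝ}
    (hv : 0 ≤ v) (huv : v ≤ u) :
    |eta ω m u - eta ω m v| ≤ ω ((u - v) / m) := by
  have hu := hv.trans huv
  unfold eta
  rw [if_pos hu, if_pos hv]
  have h1 : ω (2 * (v / m)) ≤ ω (2 * (u / m)) := om_mono h (by positivity) (by gcongr)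
  rw [abs_of_nonneg (by linarith)]
  have h2 := h.1.2.2.1 (2 * ((u - v) / m)) (2 * (v / m))
    (by have : 0 ≤ u - v := by linarith
        positivity) (by positivity)
  have e : 2 * ((u - v) / m) + 2 * (v / m) = 2 * (u / m) := by field_simp; ring
  rw [e] at h2
  have h3 := om_scale h (l := 2) (x := (u - v) / m) (by norm_num)
    (by have : 0 ≤ u - v := by linarith
        positivity)
  linarith

lemma eta_diff' {ω : ℝ → ℝ} (h : IsConcaveModulus ω) {m : ℝ} (hm : 0 < m) {u v : ℝ} (huv : v ≤ u) :
    |eta ω m u - eta ω m v| ≤ ω ((u - v) / m) := by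
  rcases le_total 0 v with hv | hv
  · exact eta_diff_nonneg h hm hv huv
  rcases le_total u 0 with hu | hu
  · have := eta_diff_nonneg h hm (u := -v) (v := -u) (by linarith) (by linarith)
    rw [eta_neg h, eta_neg h] at this
    convert this using 2 <;> ring
  · have e : eta ω m v = - eta ω m (-v) := by rw [eta_neg h, neg_neg]
    rw [e]
    unfold eta
    rw [if_pos hu, if_pos (by linarith)]
    have hv' : 0 ≤ -v := by linarith
    have h1 := om_nonneg h (x := 2 * (u / m)) (by positivity)
    have h2 := om_nonneg h (x := 2 * (-v / m)) (by positivity)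
    rw [abs_of_nonneg (by linarith)]
    have := om_mid h (a := u / m) (b := -v / m) (by positivity) (by positivity)
    have e : u / m + -v / m = (u - v) / m := by ring
    rw [e] at this
    linarith

lemma eta_diff {ω : ℝ → ℝ} (h : IsConcaveModulus ω) {m : ℝ} (hm : 0 < m) (u v : ℝ) :
    |eta ω m u - eta ω m v| ≤ ω (|u - v| / m) := by
  rcases le_total v u with huv | huv
  · rw [abs_of_nonneg (by linarith : 0 ≤ u - v)]; exact eta_diff' h hm huv
  · rw [abs_sub_comm, abs_sub_comm u, abs_of_nonneg (by linarith : 0 ≤ v - u)]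
    exact eta_diff' h hm huv

/-- amplitude / phase data -/
structure Ph (m : ℕ) (M A : ℝ) (r Θ Θ' : ℝ → ℝ) : Prop where
  hm : 0 < m
  hM : 0 ≤ M
  hMm : 2 * M ≤ m
  hΘ : ∀ t, HasDerivAt Θ (Θ' t) t
  hc : Continuous Θ'
  hb : ∀ t, |Θ' t - m| ≤ M
  hp : ∀ t, Θ (t + 2 * π) = Θ t + 2 * π * m
  r0 : ∀ t, 0 ≤ r t
  rA : ∀ t, r t ≤ A
  rc : Continuous r
  rL : ∀ s t, |r s - r t| ≤ A * M * |s - t|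
  rp : ∀ t, r (t + 2 * π) = r t

namespace Ph
variable {m : ℕ} {M A : ℝ} {r Θ Θ' : ℝ → ℝ}

lemma mpos (h : Ph m M A r Θ Θ') : (0:ℝ) < m := by exact_mod_cast h.hm

lemma A0 (h : Ph m M A r Θ Θ') : 0 ≤ A := (h.r0 0).trans (h.rA 0)

lemma cont (h : Ph m M A r Θ Θ') : Continuous Θ :=
  continuous_iff_continuousAt.2 fun t => (h.hΘ t).continuousAt

lemma lower (h : Ph m M A r Θ Θ') {s t : ℝ} (hst : s ≤ t) : (m - M) * (t - s) ≤ Θ t - Θ s := by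
  apply mul_sub_le_image_sub_of_le_deriv (fun t => (h.hΘ t).differentiableAt) _ hst
  intro x
  rw [(h.hΘ x).deriv]
  linarith [(abs_le.1 (h.hb x)).1]

lemma upper (h : Ph m M A r Θ Θ') {s t : ℝ} (hst : s ≤ t) : Θ t - Θ s ≤ (m + M) * (t - s) := by
  apply image_sub_le_mul_sub_of_deriv_le (fun t => (h.hΘ t).differentiableAt) _ hst
  intro x
  rw [(h.hΘ x).deriv]
  linarith [(abs_le.1 (h.hb x)).2]

lemma mM (h : Ph m M A r Θ Θ') : (m:ℝ) / 2 ≤ m - M := by linarith [h.hMm]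

lemma abs_lower (h : Ph m M A r Θ Θ') (s t : ℝ) : (m - M) * |t - s| ≤ |Θ t - Θ s| := by
  rcases le_total s t with hst | hst
  · rw [abs_of_nonneg (by linarith : 0 ≤ t - s)]
    exact (h.lower hst).trans (le_abs_self _)
  · rw [abs_sub_comm, abs_sub_comm (Θ t), abs_of_nonneg (by linarith : 0 ≤ s - t)]
    exact (h.lower hst).trans (le_abs_self _)

lemma abs_upper (h : Ph m M A r Θ Θ') (s t : ℝ) : |Θ t - Θ s| ≤ (m + M) * |t - s| := by
  have h1 := h.mM
  have h0 := h.mpos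
  rcases le_total s t with hst | hst
  · have h2 := h.lower hst
    have : 0 ≤ (m - M) * (t - s) := mul_nonneg (by linarith) (by linarith)
    rw [abs_of_nonneg (by linarith : 0 ≤ t - s), abs_of_nonneg (by linarith)]
    exact (h.upper hst)
  · have h2 := h.lower hst
    have : 0 ≤ (m - M) * (s - t) := mul_nonneg (by linarith) (by linarith)
    rw [abs_sub_comm, abs_sub_comm t, abs_of_nonneg (by linarith : 0 ≤ s - t),
      abs_of_nonneg (by linarith)]
    exact (h.upper hst)

lemma surj (h : Ph m M A r Θ Θ') : Function.Surjective Θ := by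
  have h1 := h.mM
  have h0 := h.mpos
  have hp : 0 < (m:ℝ) - M := by linarith
  apply h.cont.surjective
  · refine Filter.tendsto_atTop_mono' _ (f₁ := fun t => Θ 0 + (m - M) * t) ?_ ?_
    · filter_upwards [Filter.eventually_ge_atTop 0] with t ht
      have := h.lower ht
      simp only [sub_zero] at this
      linarith
    · exact Filter.tendsto_atTop_add_const_left _ _ (Filter.tendsto_id.const_mul_atTop hp)
  · refine Filter.tendsto_atBot_mono' _ (f₁ := fun t => Θ 0 + (m - M) * t) ?_ ?_
    · filter_upwards [Filter.eventually_le_atBot 0] with t ht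
      have := h.lower ht
      linarith
    · exact Filter.tendsto_atBot_add_const_left _ _ (Filter.tendsto_id.const_mul_atBot hp)

lemma exists_inv (h : Ph m M A r Θ Θ') : ∃ τ : ℝ → ℝ, (∀ t, τ (Θ t) = t) ∧ (∀ s, Θ (τ s) = s) ∧
    (∀ s s', (m - M) * |τ s - τ s'| ≤ |s - s'|) ∧ Continuous τ ∧
    (∀ s, τ (s + 2 * π * m) = τ s + 2 * π) := by
  have h1 := h.mM
  have h0 := h.mpos
  have hp : 0 < (m:ℝ) - M := by linarith
  obtain ⟨τ, hτ⟩ := h.surj.hasRightInverse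
  have hinj : ∀ s t, Θ s = Θ t → s = t := by
    intro s t hst
    have := h.abs_lower s t
    rw [hst, sub_self, abs_zero] at this
    have h3 : |t - s| ≤ 0 := by
      by_contra! hc
      have := mul_pos hp hc
      linarith
    have := abs_nonpos_iff.1 h3
    linarith
  have hlip : ∀ s s', (m - M) * |τ s - τ s'| ≤ |s - s'| := by
    intro s s'
    have := h.abs_lower (τ s') (τ s)
    rwa [hτ s, hτ s'] at this
  refine ⟨τ, fun t => hinj _ _ (hτ _), hτ, hlip, ?_, ?_⟩
  · have : LipschitzWith (Real.toNNReal (1 / (m - M))) τ := by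
      apply LipschitzWith.of_dist_le_mul
      intro x y
      rw [Real.coe_toNNReal _ (by positivity), Real.dist_eq, Real.dist_eq, one_div,
        ← div_eq_inv_mul, le_div_iff₀ hp, mul_comm]
      exact hlip x y
    exact this.continuous
  · intro s
    apply hinj
    rw [hτ, h.hp, hτ]

lemma change (h : Ph m M A r Θ Θ') {τ : ℝ → ℝ} (h1 : ∀ t, τ (Θ t) = t) (hτc : Continuous τ)
    (hτp : ∀ s, τ (s + 2 * π * m) = τ s + 2 * π) {F : ℝ → ℝ} (hF : Continuous F)
    (hFp : ∀ t, F (t + 2 * π) = F t) {B : ℝ} (hB : ∀ t, |F t| ≤ B) :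
    |m * (∫ t in (0:ℝ)..(2 * π), F t) - ∫ s in (0:ℝ)..(2 * π * m), F (τ s)| ≤ 2 * π * B * M := by
  have e1 : (∫ s in (0:ℝ)..(2 * π * m), F (τ s)) = ∫ t in (0:ℝ)..(2 * π), F t * Θ' t := by
    have hper : Function.Periodic (fun s => F (τ s)) (2 * π * m) := by
      intro s
      simp only [hτp, hFp]
    have := hper.intervalIntegral_add_eq 0 (Θ 0)
    rw [zero_add] at this
    rw [this, ← h.hp 0, zero_add]
    have := intervalIntegral.integral_comp_mul_deriv (a := 0) (b := 2 * π) (f := Θ) (f' := Θ')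
      (g := fun s => F (τ s)) (fun x _ => h.hΘ x) h.hc.continuousOn (hF.comp hτc)
    rw [← this]
    simp only [Function.comp, h1]
  rw [e1, ← intervalIntegral.integral_const_mul, ← intervalIntegral.integral_sub]
  · have := intervalIntegral.norm_integral_le_of_norm_le_const (a := 0) (b := 2 * π)
      (f := fun t => m * F t - F t * Θ' t) (C := B * M) (by
        intro t _
        have e : m * F t - F t * Θ' t = F t * (-(Θ' t - m)) := by ring
        rw [e, Real.norm_eq_abs, abs_mul, abs_neg]
        exact mul_le_mul (hB t) (h.hb t) (abs_nonneg _) ((abs_nonneg _).trans (hB t)))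
    rw [Real.norm_eq_abs] at this
    refine this.trans (le_of_eq ?_)
    rw [sub_zero, abs_of_nonneg (by positivity)]
    ring
  · exact (by fun_prop : Continuous fun t => m * F t).intervalIntegrable _ _
  · have := h.hc
    exact (by fun_prop : Continuous fun t => F t * Θ' t).intervalIntegrable _ _

end Ph

/-- center of the `k`-th window -/
def cen (k : ℕ) : ℝ := k * π + π / 2

def Wk (Φ : ℝ → ℝ) (k : ℕ) : ℝ :=
  (-1) ^ (k + 1) * ∫ u in (0:ℝ)..(π / 2), (Φ (cen k + u) - Φ (cen k - u)) * Real.sin u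

lemma cos_cen (k : ℕ) (u : ℝ) : Real.cos (cen k + u) = (-1) ^ (k + 1) * Real.sin u := by
  have : cen k + u = (u + π / 2) + k * π := by unfold cen; ring
  rw [this, Real.cos_add_nat_mul_pi, Real.cos_add_pi_div_two]; ring

lemma win_shift (f : ℝ → ℝ) (k : ℕ) :
    ∫ s in ((k:ℕ):ℝ) * π..((k + 1 : ℕ) : ℝ) * π, f s = ∫ u in (-(π / 2))..(π / 2), f (cen k + u) := by
  rw [intervalIntegral.integral_comp_add_left]
  congr 1 <;> unfold cen <;> push_cast <;> ring

lemma window {Φ ρ : ℝ → ℝ} (hΦ : Continuous Φ) (hρ : Continuous ρ) {B l : ℝ}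
    (hB : ∀ s, |Φ s| ≤ B) (hl : ∀ s t, |ρ s - ρ t| ≤ l * |s - t|) (hl0 : 0 ≤ l) (k : ℕ) :
    |(∫ s in ((k:ℕ):ℝ) * π..((k + 1 : ℕ) : ℝ) * π, Φ s * ρ s * Real.cos s) - ρ (cen k) * Wk Φ k|
      ≤ B * l * (π ^ 2 / 2) := by
  have hB0 : 0 ≤ B := (abs_nonneg _).trans (hB 0)
  have hW : Wk Φ k = ∫ u in (-(π / 2))..(π / 2), Φ (cen k + u) * Real.cos (cen k + u) := by
    have hi : ∀ a b, IntervalIntegrable (fun u => Φ (cen k + u) * Real.sin u) volume a b :=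
      fun a b => (by fun_prop : Continuous fun u => Φ (cen k + u) * Real.sin u).intervalIntegrable _ _
    have hi2 : ∀ a b, IntervalIntegrable (fun u => Φ (cen k - u) * Real.sin u) volume a b :=
      fun a b => (by fun_prop : Continuous fun u => Φ (cen k - u) * Real.sin u).intervalIntegrable _ _
    have e : ∀ u, Φ (cen k + u) * Real.cos (cen k + u) =
        (-1) ^ (k + 1) * (Φ (cen k + u) * Real.sin u) := by
      intro u; rw [cos_cen]; ring
    simp_rw [e]
    rw [intervalIntegral.integral_const_mul, Wk]
    congr 1
    rw [← intervalIntegral.integral_add_adjacent_intervals (hi (-(π / 2)) 0) (hi 0 (π / 2))]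
    have : ∫ u in (-(π / 2))..0, Φ (cen k + u) * Real.sin u =
        - ∫ u in (0:ℝ)..(π / 2), Φ (cen k - u) * Real.sin u := by
      have := intervalIntegral.integral_comp_neg (a := 0) (b := π / 2)
        (f := fun u => Φ (cen k + u) * Real.sin u)
      rw [neg_zero] at this
      rw [← this, ← intervalIntegral.integral_neg]
      congr 1
      ext u
      rw [Real.sin_neg]; ring_nf
    rw [this, neg_add_eq_sub, ← intervalIntegral.integral_sub (hi _ _) (hi2 _ _)]
    congr 1
    ext u
    ring
  rw [win_shift (fun s => Φ s * ρ s * Real.cos s), hW, ← intervalIntegral.integral_const_mul,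
    ← intervalIntegral.integral_sub]
  · have := intervalIntegral.norm_integral_le_of_norm_le_const (a := -(π / 2)) (b := π / 2)
      (f := fun u => Φ (cen k + u) * ρ (cen k + u) * Real.cos (cen k + u) -
        ρ (cen k) * (Φ (cen k + u) * Real.cos (cen k + u))) (C := B * (l * (π / 2))) (by
        intro u hu
        rw [Set.uIoc_of_le (by linarith [Real.pi_pos])] at hu
        have e : Φ (cen k + u) * ρ (cen k + u) * Real.cos (cen k + u) -
          ρ (cen k) * (Φ (cen k + u) * Real.cos (cen k + u)) =
          (Φ (cen k + u) * (ρ (cen k + u) - ρ (cen k))) * Real.cos (cen k + u) := by ring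
        rw [e, Real.norm_eq_abs, abs_mul, abs_mul]
        have h1 : |ρ (cen k + u) - ρ (cen k)| ≤ l * (π / 2) := by
          refine (hl _ _).trans ?_
          gcongr
          rw [add_sub_cancel_left, abs_le]
          exact ⟨hu.1.le, hu.2⟩
        calc _ ≤ (B * (l * (π / 2))) * 1 := by
              apply mul_le_mul _ (Real.abs_cos_le_one _) (abs_nonneg _) (by positivity)
              exact mul_le_mul (hB _) h1 (abs_nonneg _) hB0
          _ = _ := mul_one _)
    rw [Real.norm_eq_abs] at this
    refine this.trans (le_of_eq ?_)
    rw [abs_of_nonneg (by linarith [Real.pi_pos])]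
    ring
  · exact (by fun_prop : Continuous fun u =>
      Φ (cen k + u) * ρ (cen k + u) * Real.cos (cen k + u)).intervalIntegrable _ _
  · exact (by fun_prop : Continuous fun u =>
      ρ (cen k) * (Φ (cen k + u) * Real.cos (cen k + u))).intervalIntegrable _ _

lemma window' {ρ : ℝ → ℝ} (hρ : Continuous ρ) {l : ℝ}
    (hl : ∀ s t, |ρ s - ρ t| ≤ l * |s - t|) (hl0 : 0 ≤ l) (k : ℕ) :
    |(∫ s in ((k:ℕ):ℝ) * π..((k + 1 : ℕ) : ℝ) * π, ρ s) - ρ (cen k) * π|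
      ≤ l * (π ^ 2 / 2) := by
  have e0 : ρ (cen k) * π = ∫ u in (-(π / 2))..(π / 2), ρ (cen k) := by
    rw [intervalIntegral.integral_const, smul_eq_mul]; ring
  rw [win_shift ρ, e0, ← intervalIntegral.integral_sub]
  · have := intervalIntegral.norm_integral_le_of_norm_le_const (a := -(π / 2)) (b := π / 2)
      (f := fun u => ρ (cen k + u) - ρ (cen k)) (C := (l * (π / 2))) (by
        intro u hu
        rw [Set.uIoc_of_le (by linarith [Real.pi_pos])] at hu
        refine (hl _ _).trans ?_
        gcongr
        rw [add_sub_cancel_left, abs_le]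
        exact ⟨hu.1.le, hu.2⟩)
    rw [Real.norm_eq_abs] at this
    refine this.trans (le_of_eq ?_)
    rw [abs_of_nonneg (by linarith [Real.pi_pos])]
    ring
  · exact (by fun_prop : Continuous fun u => ρ (cen k + u)).intervalIntegrable _ _
  · exact (by fun_prop : Continuous fun u : ℝ => ρ (cen k)).intervalIntegrable _ _

lemma sum_windows {f : ℝ → ℝ} (hf : Continuous f) (m : ℕ) {w : ℕ → ℝ} {c : ℝ}
    (h : ∀ k, |(∫ s in ((k:ℕ):ℝ) * π..((k + 1 : ℕ) : ℝ) * π, f s) - w k| ≤ c) :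
    |(∫ s in (0:ℝ)..(2 * π * m), f s) - ∑ k ∈ Finset.range (2 * m), w k| ≤ 2 * m * c := by
  have := intervalIntegral.sum_integral_adjacent_intervals (f := f) (μ := volume)
    (a := fun k : ℕ => (k:ℝ) * π) (n := 2 * m) (fun k _ => hf.intervalIntegrable _ _)
  have e : (((2 * m : ℕ) : ℝ)) * π = 2 * π * m := by push_cast; ring
  simp only [e, Nat.cast_zero, zero_mul] at this
  rw [← this, ← Finset.sum_sub_distrib]
  refine (Finset.abs_sum_le_sum_abs _ _).trans ((Finset.sum_le_sum fun k _ => h k).trans ?_)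
  simp
namespace Ph
variable {m : ℕ} {M A : ℝ} {r Θ Θ' : ℝ → ℝ}

/-- main reduction to window sums -/
lemma reduce (h : Ph m M A r Θ Θ') {τ : ℝ → ℝ} (h1 : ∀ t, τ (Θ t) = t) (h2 : ∀ s, Θ (τ s) = s)
    (hlip : ∀ s s', (m - M) * |τ s - τ s'| ≤ |s - s'|) (hτc : Continuous τ)
    (hτp : ∀ s, τ (s + 2 * π * m) = τ s + 2 * π) {φ : ℝ → ℝ} (hφ : Continuous φ)
    (hφp : ∀ t, φ (t + 2 * π) = φ t) {B : ℝ} (hB : ∀ t, |φ t| ≤ B) :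
    |m * (∫ t in (0:ℝ)..(2 * π), φ t * (r t * Real.cos (Θ t))) -
      ∑ k ∈ Finset.range (2 * m), r (τ (cen k)) * Wk (fun s => φ (τ s)) k|
      ≤ (2 * π + 2 * π ^ 2) * (A * M * B) ∧
    |m * (∫ t in (0:ℝ)..(2 * π), r t) - ∑ k ∈ Finset.range (2 * m), r (τ (cen k)) * π|
      ≤ (2 * π + 2 * π ^ 2) * (A * M) := by
  have hB0 : 0 ≤ B := (abs_nonneg _).trans (hB 0)
  have hA0 := h.A0
  have hM0 := h.hM
  have hm0 := h.mpos
  have hmM := h.mM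
  have hΘc := h.cont
  have hrc := h.rc
  have hl0 : 0 ≤ 2 * (A * M) / m := by positivity
  have hρL : ∀ s t, |r (τ s) - r (τ t)| ≤ 2 * (A * M) / m * |s - t| := by
    intro s t
    refine (h.rL _ _).trans ?_
    have h3 : |τ s - τ t| ≤ 2 / m * |s - t| := by
      have h4 : (m:ℝ) / 2 * |τ s - τ t| ≤ |s - t| :=
        (mul_le_mul_of_nonneg_right hmM (abs_nonneg _)).trans (hlip s t)
      calc |τ s - τ t| = 2 / m * (m / 2 * |τ s - τ t|) := by field_simp
        _ ≤ _ := by gcongr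
    calc A * M * |τ s - τ t| ≤ A * M * (2 / m * |s - t|) := by gcongr
      _ = _ := by ring
  constructor
  · have a1 := h.change h1 hτc hτp (F := fun t => φ t * (r t * Real.cos (Θ t))) (B := B * A)
      (by fun_prop) (by
        intro t
        have : Real.cos (Θ t + 2 * π * m) = Real.cos (Θ t) := by
          rw [mul_comm (2 * π) (m:ℝ)]; exact Real.cos_add_nat_mul_two_pi _ _
        simp only [hφp, h.rp, h.hp, this]) (by
        intro t
        rw [abs_mul, abs_mul]
        refine mul_le_mul (hB t) ?_ (by positivity) hB0
        calc |r t| * |Real.cos (Θ t)| ≤ A * 1 := by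
              apply mul_le_mul _ (Real.abs_cos_le_one _) (abs_nonneg _) hA0
              rw [abs_of_nonneg (h.r0 t)]; exact h.rA t
          _ = A := mul_one _)
    have a2 := sum_windows (f := fun s => φ (τ s) * r (τ s) * Real.cos s) (by fun_prop) m
      (w := fun k => r (τ (cen k)) * Wk (fun s => φ (τ s)) k)
      (fun k => window (Φ := fun s => φ (τ s)) (ρ := fun s => r (τ s)) (hφ.comp hτc)
        (hrc.comp hτc) (fun s => hB _) hρL hl0 k)
    simp only [h2] at a1
    simp only [mul_assoc (φ _)] at a2
    refine (abs_sub_le _ _ _).trans ((add_le_add a1 a2).trans (le_of_eq ?_))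
    field_simp
  · have a1 := h.change h1 hτc hτp (F := r) (B := A) hrc h.rp (by
        intro t
        rw [abs_of_nonneg (h.r0 t)]; exact h.rA t)
    have a2 := sum_windows (f := fun s => r (τ s)) (by fun_prop) m
      (w := fun k => r (τ (cen k)) * π)
      (fun k => window' (ρ := fun s => r (τ s)) (hrc.comp hτc) hρL hl0 k)
    refine (abs_sub_le _ _ _).trans ((add_le_add a1 a2).trans (le_of_eq ?_))
    field_simp

lemma upper_bound (h : Ph m M A r Θ Θ') {ω : ℝ → ℝ} (hω : IsConcaveModulus ω) {φ : ℝ → ℝ}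
    (hφ : φ ∈ Hclass ω) (hB : ∀ t, |φ t| ≤ ω π) :
    |∫ t in (0:ℝ)..(2 * π), φ t * (r t * Real.cos (Θ t))| ≤
      (∫ t in (0:ℝ)..(2 * π), r t) * eInt m ω / π + 100 * (A * M * ω π / m) := by
  obtain ⟨τ, h1, h2, hlip, hτc, hτp⟩ := h.exists_inv
  have hA0 := h.A0
  have hM0 := h.hM
  have hm0 := h.mpos
  have hmM := h.mM
  have hφc := hφ.1
  obtain ⟨R1, R2⟩ := h.reduce h1 h2 hlip hτc hτp hφ.1 hφ.2.1 hB
  set J := ∫ t in (0:ℝ)..(2 * π), φ t * (r t * Real.cos (Θ t))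
  set K := ∫ t in (0:ℝ)..(2 * π), r t
  have he0 := eInt_nonneg hω m
  have heB := eInt_le hω h.hm
  set e := eInt m ω with he
  have hB0 : 0 ≤ ω π := om_nonneg hω Real.pi_pos.le
  have hW : ∀ k, |Wk (fun s => φ (τ s)) k| ≤ (1 + 2 * M / m) * e := by
    intro k
    rw [Wk, abs_mul, abs_pow, abs_neg, abs_one, one_pow, one_mul, he, eInt_eq,
      ← intervalIntegral.integral_const_mul, ← Real.norm_eq_abs]
    apply intervalIntegral.norm_integral_le_of_norm_le (by positivity)
    · refine Filter.Eventually.of_forall fun u hu => ?_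
      have hs := Real.sin_nonneg_of_nonneg_of_le_pi hu.1.le (by linarith [hu.2, Real.pi_pos])
      rw [norm_mul, Real.norm_eq_abs, Real.norm_eq_abs, abs_of_nonneg hs, ← mul_assoc]
      apply mul_le_mul_of_nonneg_right _ hs
      refine (hφ.2.2 _ _).trans ?_
      refine le_trans ?_ (om_scale hω (by
        have : 0 ≤ 2 * M / m := by positivity
        linarith) (abs_nonneg _))
      apply om_mono hω (abs_nonneg _)
      have h3 := hlip (cen k + u) (cen k - u)
      have e1 : cen k + u - (cen k - u) = 2 * u := by ring
      rw [e1] at h3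
      have hp : 0 < (m:ℝ) - M := by linarith
      rw [abs_div, abs_of_pos hm0]
      have h4 : |τ (cen k + u) - τ (cen k - u)| ≤ |2 * u| / (m - M) := by
        rw [le_div_iff₀ hp, mul_comm]; exact h3
      refine h4.trans ?_
      rw [div_le_iff₀ hp]
      have h5 : 1 ≤ (1 + 2 * M / m) * (1 / m) * (m - M) := by
        have e2 : (1 + 2 * M / m) * (1 / m) * (m - M) = (m + 2 * M) * (m - M) / (m * m) := by
          field_simp
        rw [e2, le_div_iff₀ (by positivity)]
        nlinarith [h.hMm]
      calc |2 * u| = |2 * u| * 1 := (mul_one _).symm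
        _ ≤ |2 * u| * ((1 + 2 * M / m) * (1 / m) * (m - M)) := by gcongr
        _ = _ := by ring
    · apply Continuous.intervalIntegrable
      exact continuous_const.mul ((om_comp_cont hω (by fun_prop)).mul Real.continuous_sin)
  have hS : |∑ k ∈ Finset.range (2 * m), r (τ (cen k)) * Wk (fun s => φ (τ s)) k| ≤
      (∑ k ∈ Finset.range (2 * m), r (τ (cen k))) * e + 4 * (A * M * ω π) := by
    calc _ ≤ ∑ k ∈ Finset.range (2 * m), (r (τ (cen k)) * e + A * (2 * M / m) * ω π) := by
          refine (Finset.abs_sum_le_sum_abs _ _).trans (Finset.sum_le_sum fun k _ => ?_)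
          rw [abs_mul, abs_of_nonneg (h.r0 _)]
          calc _ ≤ r (τ (cen k)) * ((1 + 2 * M / m) * e) :=
                mul_le_mul_of_nonneg_left (hW k) (h.r0 _)
            _ = r (τ (cen k)) * e + r (τ (cen k)) * (2 * M / m) * e := by ring
            _ ≤ _ := by
              have := h.rA (τ (cen k))
              gcongr
      _ = _ := by
        rw [Finset.sum_add_distrib, Finset.sum_const, Finset.card_range, nsmul_eq_mul,
          ← Finset.sum_mul]
        congr 1
        push_cast
        field_simp
        ring
  rw [← Finset.sum_mul] at R2
  set S := ∑ k ∈ Finset.range (2 * m), r (τ (cen k))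
  have hpi := Real.pi_pos
  have hpi2 : π ≤ 3.15 := Real.pi_lt_d2.le
  have hpi3 : 3 ≤ π := Real.pi_gt_three.le
  have hAM : 0 ≤ A * M := by positivity
  have hP : 2 * π + 2 * π ^ 2 ≤ 27 := by nlinarith
  have hAMB : 0 ≤ A * M * ω π := by positivity
  -- S * e ≤ m K e / π + 27 A M e / π
  have hSe : S * e ≤ m * (K * e / π) + 9 * (A * M * ω π) := by
    have t1 : S * π ≤ m * K + 27 * (A * M) := by
      have := (abs_le.1 R2).1
      nlinarith
    have t2 : S ≤ m * K / π + 9 * (A * M) := by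
      have : S ≤ (m * K + 27 * (A * M)) / π := by rwa [le_div_iff₀ hpi]
      refine this.trans ?_
      rw [add_div]
      have : 27 * (A * M) / π ≤ 9 * (A * M) := by
        rw [div_le_iff₀ hpi]; nlinarith
      linarith
    calc S * e ≤ (m * K / π + 9 * (A * M)) * e := by gcongr
      _ = m * (K * e / π) + 9 * (A * M) * e := by ring
      _ ≤ m * (K * e / π) + 9 * (A * M) * ω π := by gcongr
      _ = _ := by ring
  have hfin : |m * J| ≤ m * (K * e / π) + 100 * (A * M * ω π) := by
    have t := abs_sub_abs_le_abs_sub (m * J)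
      (∑ k ∈ Finset.range (2 * m), r (τ (cen k)) * Wk (fun s => φ (τ s)) k)
    have : (2 * π + 2 * π ^ 2) * (A * M * ω π) ≤ 27 * (A * M * ω π) := by gcongr
    linarith
  rw [abs_mul, abs_of_pos hm0] at hfin
  have : m * |J| ≤ m * (K * e / π + 100 * (A * M * ω π / m)) := by
    refine hfin.trans (le_of_eq ?_)
    field_simp
  exact le_of_mul_le_mul_left this hm0

lemma lower_bound (h : Ph m M A r Θ Θ') {ω : ℝ → ℝ} (hω : IsConcaveModulus ω) :
    ∃ φ ∈ Hclass ω, 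
      (∫ t in (0:ℝ)..(2 * π), r t) * eInt m ω / π - 100 * (A * M * ω π / m) ≤ 
      ∫ t in (0:ℝ)..(2 * π), φ t * (r t * Real.cos (Θ t)) := by
  obtain ⟨τ, h1, h2, hlip, hτc, hτp⟩ := h.exists_inv
  have hA0 := h.A0
  have hM0 := h.hM
  have hm0 := h.mpos
  have hmM := h.mM
  have hB0 : 0 ≤ ω π := om_nonneg hω Real.pi_pos.le
  set c0 : ℝ := 1 / (1 + M / m) with hc0
  have hq0 : 0 ≤ M / m := by positivity
  have hc0p : 0 < c0 := by positivity
  have hc01 : c0 ≤ 1 := by rw [hc0, div_le_one (by positivity)]; linarith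
  have hc02 : 1 - M / m ≤ c0 := by
    rw [hc0, le_div_iff₀ (by positivity)]
    nlinarith
  set φ : ℝ → ℝ := fun t => c0 * eta ω m (tri (Θ t)) with hφdef
  have hmod : ∀ s t, |φ s - φ t| ≤ ω |s - t| := by
    intro s t
    have e1 : φ s - φ t = c0 * (eta ω m (tri (Θ s)) - eta ω m (tri (Θ t))) := by
      simp only [hφdef]; ring
    rw [e1, abs_mul, abs_of_pos hc0p]
    have a1 := eta_diff hω hm0 (tri (Θ s)) (tri (Θ t))
    have a2 : ω (|tri (Θ s) - tri (Θ t)| / m) ≤ ω ((1 + M / m) * |s - t|) := by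
      apply om_mono hω (by positivity)
      rw [div_le_iff₀ hm0]
      refine (tri_lip _ _).trans ((h.abs_upper t s).trans (le_of_eq ?_))
      field_simp
    have a3 := om_scale hω (l := 1 + M / m) (x := |s - t|) (by linarith) (abs_nonneg _)
    calc _ ≤ c0 * ((1 + M / m) * ω |s - t|) := by
          apply mul_le_mul_of_nonneg_left _ hc0p.le
          linarith
      _ = _ := by rw [hc0]; field_simp
  have hper : ∀ x, φ (x + 2 * π) = φ x := by
    intro x
    have : Real.cos (Θ x + 2 * π * m) = Real.cos (Θ x) := by
      rw [mul_comm (2 * π) (m:ℝ)]; exact Real.cos_add_nat_mul_two_pi _ _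
    simp only [hφdef, h.hp, tri, this]
  have hcont := cont_of_mod hω hmod
  refine ⟨φ, ⟨hcont, hper, hmod⟩, ?_⟩
  have heta0 : eta ω m 0 = 0 := by simp [eta, hω.1.2.2.2]
  have hB : ∀ t, |φ t| ≤ ω π := by
    intro t
    simp only [hφdef]
    rw [abs_mul, abs_of_pos hc0p]
    have a1 := eta_diff hω hm0 (tri (Θ t)) 0
    rw [heta0, sub_zero, sub_zero] at a1
    have a2 : ω (|tri (Θ t)| / m) ≤ ω π := by
      apply om_mono hω (by positivity)
      have b1 := Real.neg_pi_div_two_le_arcsin (Real.cos (Θ t))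
      have b2 := Real.arcsin_le_pi_div_two (Real.cos (Θ t))
      have b3 : |tri (Θ t)| ≤ π := by
        unfold tri; rw [abs_le]; constructor <;> linarith [Real.pi_pos]
      refine (div_le_self (abs_nonneg _) ?_).trans b3
      exact_mod_cast h.hm
    calc _ ≤ 1 * ω π := mul_le_mul hc01 (a1.trans a2) (abs_nonneg _) (by norm_num)
      _ = _ := one_mul _
  obtain ⟨R1, R2⟩ := h.reduce h1 h2 hlip hτc hτp hcont hper hB
  set J := ∫ t in (0:ℝ)..(2 * π), φ t * (r t * Real.cos (Θ t))
  set K := ∫ t in (0:ℝ)..(2 * π), r t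
  have he0 := eInt_nonneg hω m
  have heB := eInt_le hω h.hm
  set e := eInt m ω with he
  have htri : ∀ k u, |u| ≤ π / 2 → tri (cen k + u) = (-1) ^ (k + 1) * u := by
    intro k u hu
    rw [abs_le] at hu
    rw [tri, cos_cen]
    rcases neg_one_pow_eq_or ℝ (k + 1) with hk | hk <;> rw [hk]
    · rw [one_mul, one_mul, Real.arcsin_sin hu.1 hu.2]
    · rw [neg_one_mul, neg_one_mul, Real.arcsin_neg, Real.arcsin_sin hu.1 hu.2]
  have hφτ : ∀ k u, |u| ≤ π / 2 → φ (τ (cen k + u)) = (-1) ^ (k + 1) * (c0 * eta ω m u) := by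
    intro k u hu
    simp only [hφdef]
    rw [h2, htri k u hu]
    rcases neg_one_pow_eq_or ℝ (k + 1) with hk | hk <;> rw [hk]
    · rw [one_mul, one_mul]
    · rw [neg_one_mul, neg_one_mul, eta_neg hω, mul_neg]
  have hW : ∀ k, Wk (fun s => φ (τ s)) k = c0 * e := by
    intro k
    rw [Wk, he, eInt, ← intervalIntegral.integral_const_mul, ← intervalIntegral.integral_const_mul]
    apply intervalIntegral.integral_congr
    intro u hu
    rw [Set.uIcc_of_le (by positivity)] at hu
    have hu0 := hu.1
    have hu1 : |u| ≤ π / 2 := by rw [abs_of_nonneg hu0]; exact hu.2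
    have hu2 : |-u| ≤ π / 2 := by rwa [abs_neg]
    have hee : eta ω m u = ω (2 * u / m) / 2 := by
      rw [eta, if_pos hu0, mul_div_assoc]
    have hs : ((-1:ℝ) ^ (k + 1)) * ((-1) ^ (k + 1)) = 1 := by
      rw [← mul_pow]; norm_num
    simp only [sub_eq_add_neg (cen k) u, hφτ k u hu1, hφτ k (-u) hu2, eta_neg hω, hee]
    linear_combination (c0 * ω (2 * u / m) * Real.sin u) * hs
  have hS : (∑ k ∈ Finset.range (2 * m), r (τ (cen k))) * e - 2 * (A * M * ω π) ≤ 
      ∑ k ∈ Finset.range (2 * m), r (τ (cen k)) * Wk (fun s => φ (τ s)) k := by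
    calc _ = ∑ k ∈ Finset.range (2 * m), (r (τ (cen k)) * e - A * (M / m) * ω π) := by
          rw [Finset.sum_sub_distrib, Finset.sum_const, Finset.card_range, nsmul_eq_mul,
            ← Finset.sum_mul]
          congr 1
          push_cast
          field_simp
      _ ≤ _ := by
        refine (Finset.sum_le_sum fun k _ => ?_)
        rw [hW]
        have hr := h.r0 (τ (cen k))
        have t1 : r (τ (cen k)) * ((1 - M / m) * e) ≤ r (τ (cen k)) * (c0 * e) := by gcongr
        have t2 : r (τ (cen k)) * (M / m) * e ≤ A * (M / m) * ω π := by
          have := h.rA (τ (cen k))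
          gcongr
        linarith
  rw [← Finset.sum_mul] at R2
  set S := ∑ k ∈ Finset.range (2 * m), r (τ (cen k))
  have hpi := Real.pi_pos
  have hpi2 : π ≤ 3.15 := Real.pi_lt_d2.le
  have hpi3 : 3 ≤ π := Real.pi_gt_three.le
  have hAM : 0 ≤ A * M := by positivity
  have hP : 2 * π + 2 * π ^ 2 ≤ 27 := by nlinarith
  have hAMB : 0 ≤ A * M * ω π := by positivity
  have hSe : m * (K * e / π) - 9 * (A * M * ω π) ≤ S * e := by
    have t1 : m * K - 27 * (A * M) ≤ S * π := by
      have := (abs_le.1 R2).2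
      nlinarith
    have t2 : m * K / π - 9 * (A * M) ≤ S := by
      have : (m * K - 27 * (A * M)) / π ≤ S := by rwa [div_le_iff₀ hpi]
      refine le_trans ?_ this
      rw [sub_div]
      have : 27 * (A * M) / π ≤ 9 * (A * M) := by
        rw [div_le_iff₀ hpi]; nlinarith
      linarith
    have t3 : 9 * (A * M) * e ≤ 9 * (A * M) * ω π := by gcongr
    have t4 : (m * K / π - 9 * (A * M)) * e ≤ S * e := by gcongr
    have t5 : (m * K / π - 9 * (A * M)) * e = m * (K * e / π) - 9 * (A * M) * e := by ring
    linarith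
  have hfin : m * (K * e / π) - 100 * (A * M * ω π) ≤ m * J := by
    have t := (abs_le.1 R1).1
    have : (2 * π + 2 * π ^ 2) * (A * M * ω π) ≤ 27 * (A * M * ω π) := by gcongr
    linarith
  have : m * (K * e / π - 100 * (A * M * ω π / m)) ≤ m * J := by
    refine le_trans (le_of_eq ?_) hfin
    field_simp
  exact le_of_mul_le_mul_left this hm0

end Ph

def zq (q t : ℝ) : ℂ := (q : ℂ) * Complex.exp (t * Complex.I)

def Gq (p : ℕ) (q t : ℝ) : ℂ := (1 - zq q t ^ p) / (1 - zq q t) ^ 2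

def Lam (p : ℕ) (q t : ℝ) : ℂ := Complex.log (1 - zq q t ^ p) - 2 * Complex.log (1 - zq q t)

def Lam' (p : ℕ) (q t : ℝ) : ℂ :=
  -(p * (zq q t ^ p * Complex.I)) / (1 - zq q t ^ p) - 2 * (-(zq q t * Complex.I) / (1 - zq q t))

section

lemma norm_zq {q : ℝ} (hq : q ∈ Set.Ioo (0:ℝ) 1) (t : ℝ) : ‖zq q t‖ = q := by
  rw [zq, norm_mul, Complex.norm_exp_ofReal_mul_I, mul_one, Complex.norm_real, Real.norm_eq_abs,
    abs_of_pos hq.1]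

lemma norm_zq_pow_lt {q : ℝ} (hq : q ∈ Set.Ioo (0:ℝ) 1) {p : ℕ} (hp : 0 < p) (t : ℝ) : ‖zq q t ^ p‖ < 1 := by
  rw [norm_pow, norm_zq hq]
  exact pow_lt_one₀ hq.1.le hq.2 hp.ne'

lemma slit {q : ℝ} (hq : q ∈ Set.Ioo (0:ℝ) 1) {p : ℕ} (hp : 0 < p) (t : ℝ) : 1 - zq q t ^ p ∈ Complex.slitPlane := by
  rw [sub_eq_add_neg]
  apply Complex.mem_slitPlane_of_norm_lt_one
  rw [norm_neg]; exact norm_zq_pow_lt hq hp t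

lemma slit1 {q : ℝ} (hq : q ∈ Set.Ioo (0:ℝ) 1) (t : ℝ) : 1 - zq q t ∈ Complex.slitPlane := by
  simpa using slit hq (p := 1) one_pos t

lemma exp_Lam {q : ℝ} (hq : q ∈ Set.Ioo (0:ℝ) 1) {p : ℕ} (hp : 0 < p) (t : ℝ) : Complex.exp (Lam p q t) = Gq p q t := by
  rw [Lam, Complex.exp_sub, two_mul, Complex.exp_add,
    Complex.exp_log (Complex.slitPlane_ne_zero (slit hq hp t)),
    Complex.exp_log (Complex.slitPlane_ne_zero (slit1 hq t)), Gq, sq]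

lemma zq_deriv {q : ℝ} (t : ℝ) : HasDerivAt (zq q) (zq q t * Complex.I) t := by
  have h1 : HasDerivAt (fun t : ℝ => (t : ℂ) * Complex.I) Complex.I t := by
    simpa using (Complex.ofRealCLM.hasDerivAt (x := t)).mul_const Complex.I
  have := (h1.cexp).const_mul (q : ℂ)
  refine this.congr_deriv ?_
  simp only [zq]; ring

lemma zq_cont {q : ℝ} : Continuous (zq q) := by unfold zq; fun_prop

lemma Lam_deriv {q : ℝ} (hq : q ∈ Set.Ioo (0:ℝ) 1) {p : ℕ} (hp : 0 < p) (t : ℝ) : HasDerivAt (Lam p q) (Lam' p q t) t := by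
  have hz := zq_deriv (q := q) t
  have h1 : HasDerivAt (fun t => 1 - zq q t ^ p) (-(p * (zq q t ^ p * Complex.I))) t := by
    refine ((hz.pow p).const_sub 1).congr_deriv ?_
    obtain ⟨k, rfl⟩ : ∃ k, p = k + 1 := ⟨p - 1, by omega⟩
    simp only [Nat.add_sub_cancel]
    ring
  have h2 : HasDerivAt (fun t => 1 - zq q t) (-(zq q t * Complex.I)) t := hz.const_sub 1
  exact (h1.clog_real (slit hq hp t)).sub ((h2.clog_real (slit1 hq t)).const_mul 2)

lemma Lam'_cont {q : ℝ} (hq : q ∈ Set.Ioo (0:ℝ) 1) {p : ℕ} (hp : 0 < p) : Continuous (Lam' p q) := by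
  have := zq_cont (q := q)
  have h1 : ∀ t, 1 - zq q t ^ p ≠ 0 := fun t => Complex.slitPlane_ne_zero (slit hq hp t)
  have h2 : ∀ t, 1 - zq q t ≠ 0 := fun t => Complex.slitPlane_ne_zero (slit1 hq t)
  unfold Lam'
  fun_prop (disch := assumption)

lemma one_sub_norm {q : ℝ} (hq : q ∈ Set.Ioo (0:ℝ) 1) {p : ℕ} (t : ℝ) : 1 - q ^ p ≤ ‖1 - zq q t ^ p‖ := by
  have := norm_sub_norm_le (1:ℂ) (zq q t ^ p)
  rwa [norm_pow, norm_zq hq, norm_one] at this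

lemma one_sub_norm1 {q : ℝ} (hq : q ∈ Set.Ioo (0:ℝ) 1) (t : ℝ) : 1 - q ≤ ‖1 - zq q t‖ := by
  simpa using one_sub_norm hq (p := 1) t

lemma Lam'_bound {q : ℝ} (hq : q ∈ Set.Ioo (0:ℝ) 1) {p : ℕ} (hp : 0 < p) (t : ℝ) : ‖Lam' p q t‖ ≤ 3 / (1 - q) := by
  have hq1 : 0 < 1 - q := by linarith [hq.2]
  have hqp : 0 < 1 - q ^ p := by linarith [pow_lt_one₀ hq.1.le hq.2 hp.ne']
  have a1 : ‖-(p * (zq q t ^ p * Complex.I)) / (1 - zq q t ^ p)‖ ≤ 1 / (1 - q) := by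
    rw [norm_div, norm_neg, norm_mul, norm_mul, Complex.norm_I, mul_one, norm_pow, norm_zq hq,
      Complex.norm_natCast]
    have h1 := one_sub_norm hq (p := p) t
    calc (p:ℝ) * q ^ p / ‖1 - zq q t ^ p‖ ≤ p * q ^ p / (1 - q ^ p) := by
          have := hq.1
          gcongr
      _ ≤ 1 / (1 - q) := by
        rw [div_le_div_iff₀ hqp hq1, one_mul]
        have h2 : 1 - q ^ p = (∑ i ∈ Finset.range p, q ^ i) * (1 - q) := (geom_sum_mul_neg q p).symm
        rw [h2]
        gcongr
        calc (p:ℝ) * q ^ p = ∑ i ∈ Finset.range p, q ^ p := by simp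
          _ ≤ _ := Finset.sum_le_sum fun i hi =>
            pow_le_pow_of_le_one hq.1.le hq.2.le (Finset.mem_range.1 hi).le
  have a2 : ‖2 * (-(zq q t * Complex.I) / (1 - zq q t))‖ ≤ 2 / (1 - q) := by
    rw [norm_mul, norm_div, norm_neg, norm_mul, Complex.norm_I, mul_one, norm_zq hq,
      Complex.norm_ofNat, mul_div_assoc']
    have h1 := one_sub_norm1 hq t
    have := hq.2
    gcongr
    linarith
  unfold Lam'
  refine (norm_sub_le _ _).trans ((add_le_add a1 a2).trans (le_of_eq ?_))
  ring

lemma zq_per {q : ℝ} (t : ℝ) : zq q (t + 2 * π) = zq q t := by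
  unfold zq
  congr 1
  push_cast
  rw [add_mul]
  exact Complex.exp_periodic _

lemma ph_main {q : ℝ} (hq : q ∈ Set.Ioo (0:ℝ) 1) {p : ℕ} (hp : 0 < p) {m : ℕ} (hm : 6 / (1 - q) ≤ m) (γ : ℝ) {A : ℝ}
    (hA : ∀ t, ‖Gq p q t‖ ≤ A) :
    Ph m (3 / (1 - q)) A (fun t => ‖Gq p q t‖) (fun t => m * t + γ + (Lam p q t).im)
      (fun t => m + (Lam' p q t).im) := by
  have hq1 : 0 < 1 - q := by linarith [hq.2]
  have hA0 : 0 ≤ A := (norm_nonneg _).trans (hA 0)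
  have hGd : ∀ t, HasDerivAt (Gq p q) (Gq p q t * Lam' p q t) t := by
    intro t
    have := (Lam_deriv hq hp t).cexp
    rw [exp_Lam hq hp] at this
    refine this.congr_of_eventuallyEq (Filter.Eventually.of_forall fun s => ?_)
    exact (exp_Lam hq hp s).symm
  refine ⟨?_, by positivity, ?_, ?_, ?_, ?_, ?_, fun t => norm_nonneg _, hA, ?_, ?_, ?_⟩
  · have : (0:ℝ) < m := lt_of_lt_of_le (by positivity) hm
    exact_mod_cast this
  · refine le_trans (le_of_eq ?_) hm
    ring
  · intro t
    have h1 : HasDerivAt (fun t => (Lam p q t).im) (Lam' p q t).im t :=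
      (Complex.imCLM.hasFDerivAt.comp_hasDerivAt t (Lam_deriv hq hp t))
    have h2 : HasDerivAt (fun t : ℝ => (m:ℝ) * t + γ) m t := by
      simpa using ((hasDerivAt_id t).const_mul (m:ℝ)).add_const γ
    exact h2.add h1
  · exact continuous_const.add (Complex.continuous_im.comp (Lam'_cont hq hp))
  · intro t
    rw [add_sub_cancel_left]
    exact (Complex.abs_im_le_norm _).trans (Lam'_bound hq hp t)
  · intro t
    simp only [Lam, zq_per]
    ring
  · exact (continuous_iff_continuousAt.2 fun t => (hGd t).continuousAt).norm
  · intro s t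
    refine (abs_norm_sub_norm_le _ _).trans ?_
    rw [← Real.norm_eq_abs]
    refine Convex.norm_image_sub_le_of_norm_hasDerivWithin_le (s := Set.univ)
      (fun x _ => (hGd x).hasDerivWithinAt) (fun x _ => ?_) convex_univ (Set.mem_univ _)
      (Set.mem_univ _)
    rw [norm_mul]
    exact mul_le_mul (hA x) (Lam'_bound hq hp x) (norm_nonneg _) hA0
  · intro t
    simp only [Gq, zq_per]

lemma re_kernel {q : ℝ} (hq : q ∈ Set.Ioo (0:ℝ) 1) {p : ℕ} (hp : 0 < p) (m : ℕ) (γ t : ℝ) :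
    (Complex.exp (((m * t + γ : ℝ) : ℂ) * Complex.I) * Gq p q t).re =
      ‖Gq p q t‖ * Real.cos (m * t + γ + (Lam p q t).im) := by
  rw [← exp_Lam hq hp, ← Complex.exp_add, Complex.exp_re, Complex.norm_exp]
  simp

lemma G_bound {q : ℝ} (hq : q ∈ Set.Ioo (0:ℝ) 1) (p : ℕ) (t : ℝ) : ‖Gq p q t‖ ≤ 2 / (1 - q) ^ (δp p - 1) := by
  have hq1 : 0 < 1 - q := by linarith [hq.2]
  have hn := one_sub_norm1 hq t
  have hn0 : 0 < ‖1 - zq q t‖ := lt_of_lt_of_le hq1 hn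
  by_cases h1 : p = 1
  · subst h1
    rw [Gq, norm_div, norm_pow, pow_one]
    simp only [δp, if_true]
    rw [div_le_div_iff₀ (by positivity) (by positivity)]
    norm_num
    nlinarith
  · rw [Gq, norm_div, norm_pow]
    simp only [δp, if_neg h1]
    have h2 : ‖1 - zq q t ^ p‖ ≤ 2 := by
      refine (norm_sub_le _ _).trans ?_
      rw [norm_one, norm_pow, norm_zq hq]
      linarith [pow_le_one₀ (n := p) hq.1.le hq.2.le]
    norm_num
    gcongr

lemma Kpq_eq {q : ℝ} (p : ℕ) : Kpq p q = ∫ t in (0:ℝ)..(2 * π), ‖Gq p q t‖ := by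
  have key : ∀ (t : ℝ) (k : ℕ), ‖1 - zq q t ^ k‖ ^ 2 = 1 - 2 * q ^ k * Real.cos (k * t) + q ^ (2 * k) := by
    intro t k
    have e : zq q t ^ k = ((q ^ k : ℝ) : ℂ) * Complex.exp (((k * t : ℝ) : ℂ) * Complex.I) := by
      rw [zq, mul_pow, ← Complex.exp_nat_mul]
      push_cast
      ring_nf
    rw [e, Complex.sq_norm, Complex.normSq_apply]
    simp [Complex.exp_ofReal_mul_I_re, Complex.exp_ofReal_mul_I_im, -Complex.ofReal_mul, -Complex.ofReal_pow]
    linear_combination (q ^ k) ^ 2 * Real.sin_sq_add_cos_sq (k * t)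
  unfold Kpq
  congr 1
  ext t
  rw [Gq, norm_div, norm_pow, ← key t p, Real.sqrt_sq (norm_nonneg _)]
  congr 1
  simpa using (key t 1).symm

end
/-- real part kernel of order `k` -/
def Rk (q γ : ℝ) (k : ℕ) (t : ℝ) : ℝ :=
  (Complex.exp ((γ : ℂ) * Complex.I) * (zq q t ^ (k + 1) / (1 - zq q t))).re

lemma re_term (q γ t : ℝ) (k : ℕ) :
    (Complex.exp ((γ : ℂ) * Complex.I) * zq q t ^ k).re = q ^ k * Real.cos (k * t + γ) := by
  have e : Complex.exp ((γ : ℂ) * Complex.I) * zq q t ^ k =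
      ((q ^ k : ℝ) : ℂ) * Complex.exp (((k * t + γ : ℝ) : ℂ) * Complex.I) := by
    rw [zq, mul_pow, ← Complex.exp_nat_mul]
    push_cast
    rw [add_mul, Complex.exp_add]
    ring_nf
  rw [e, Complex.re_ofReal_mul, Complex.exp_ofReal_mul_I_re]

section

lemma Pker_hasSum {q : ℝ} (hq : q ∈ Set.Ioo (0:ℝ) 1) (β t : ℝ) :
    HasSum (fun k : ℕ => q ^ (k + 1) * Real.cos ((k + 1 : ℕ) * t + β * π / 2))
      (Rk q (β * π / 2) 0 t) := by
  have hz : ‖zq q t‖ < 1 := by rw [norm_zq hq]; exact hq.2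
  have h1 := (hasSum_geometric_of_norm_lt_one hz).mul_left
    (Complex.exp (((β * π / 2 : ℝ) : ℂ) * Complex.I) * zq q t)
  have h2 := Complex.hasSum_re h1
  have e : Rk q (β * π / 2) 0 t = (Complex.exp (((β * π / 2 : ℝ) : ℂ) * Complex.I) * zq q t *
      (1 - zq q t)⁻¹).re := by
    rw [Rk, zero_add, pow_one, mul_assoc, div_eq_mul_inv (zq q t)]
  rw [e]
  convert h2 using 2 with k
  rw [← re_term, pow_succ']
  ring_nf

lemma Pker_eq {q : ℝ} (hq : q ∈ Set.Ioo (0:ℝ) 1) (β t : ℝ) : Pker q β t = Rk q (β * π / 2) 0 t := (Pker_hasSum hq β t).tsum_eq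

lemma Rk_cont {q : ℝ} (hq : q ∈ Set.Ioo (0:ℝ) 1) (γ : ℝ) (k : ℕ) : Continuous (Rk q γ k) := by
  have := zq_cont (q := q)
  have h2 : ∀ t, 1 - zq q t ≠ 0 := fun t => Complex.slitPlane_ne_zero (slit1 hq t)
  unfold Rk
  apply Complex.continuous_re.comp
  fun_prop (disch := assumption)

lemma Pker_cont {q : ℝ} (hq : q ∈ Set.Ioo (0:ℝ) 1) (β : ℝ) : Continuous (Pker q β) := by
  have : Pker q β = Rk q (β * π / 2) 0 := funext (Pker_eq hq β)
  rw [this]; exact Rk_cont hq _ _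

lemma Rk_succ {q : ℝ} (hq : q ∈ Set.Ioo (0:ℝ) 1) (γ : ℝ) (k : ℕ) (t : ℝ) :
    Rk q γ (k + 1) t = Rk q γ k t - q ^ (k + 1) * Real.cos ((k + 1 : ℕ) * t + γ) := by
  have h2 : 1 - zq q t ≠ 0 := Complex.slitPlane_ne_zero (slit1 hq t)
  rw [← re_term, Rk, Rk, ← Complex.sub_re]
  congr 1
  field_simp
  ring

lemma Rk_eq_sub {q : ℝ} (hq : q ∈ Set.Ioo (0:ℝ) 1) (γ : ℝ) (k : ℕ) (t : ℝ) :
    Rk q γ k t = Rk q γ 0 t - ∑ j ∈ Finset.Icc 1 k, q ^ j * Real.cos (j * t + γ) := by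
  induction k with
  | zero => simp
  | succ k ih => rw [Rk_succ hq, ih, Finset.sum_Icc_succ_top (by omega)]; ring

lemma int_cos_int (k : ℤ) (hk : k ≠ 0) (a : ℝ) :
    ∫ u in (0:ℝ)..(2 * π), Real.cos (k * u + a) = 0 := by
  have hk' : (k:ℝ) ≠ 0 := by exact_mod_cast hk
  rw [intervalIntegral.integral_comp_mul_add (fun x => Real.cos x) hk', integral_cos]
  have : Real.sin (k * (2 * π) + a) = Real.sin a := by
    rw [add_comm]; exact Real.sin_add_int_mul_two_pi _ _
  rw [this, mul_zero, zero_add, sub_self, smul_zero]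

lemma orth (k j : ℕ) (a b : ℝ) :
    ∫ u in (0:ℝ)..(2 * π), Real.cos ((k + 1 : ℕ) * u + a) * Real.cos (j * u - b) =
      if j = k + 1 then π * Real.cos (a + b) else 0 := by
  have e : ∀ u : ℝ, Real.cos ((k + 1 : ℕ) * u + a) * Real.cos (j * u - b) =
      (1 / 2) * Real.cos (((k + 1 + j : ℤ) : ℝ) * u + (a - b)) +
      (1 / 2) * Real.cos (((k + 1 - j : ℤ) : ℝ) * u + (a + b)) := by
    intro u
    have h1 : ((k + 1 + j : ℤ) : ℝ) * u + (a - b) = ((k + 1 : ℕ) * u + a) + (j * u - b) := by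
      push_cast; ring
    have h2 : ((k + 1 - j : ℤ) : ℝ) * u + (a + b) = ((k + 1 : ℕ) * u + a) - (j * u - b) := by
      push_cast; ring
    rw [h1, h2]
    generalize ((k + 1 : ℕ) : ℝ) * u + a = X
    generalize (j : ℝ) * u - b = Y
    rw [Real.cos_add, Real.cos_sub]; ring
  simp_rw [e]
  rw [intervalIntegral.integral_add
    ((by fun_prop : Continuous _).intervalIntegrable _ _)
    ((by fun_prop : Continuous _).intervalIntegrable _ _),
    intervalIntegral.integral_const_mul, intervalIntegral.integral_const_mul,
    int_cos_int _ (by omega)]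
  split_ifs with h
  · subst h
    simp
    ring
  · rw [int_cos_int _ (by omega)]; simp

lemma Pker_coef {q : ℝ} (hq : q ∈ Set.Ioo (0:ℝ) 1) (β : ℝ) (j : ℕ) (y : ℝ) :
    ∫ u in (0:ℝ)..(2 * π), Pker q β u * Real.cos (j * u - y) =
      if j = 0 then 0 else π * (q ^ j * Real.cos (y + β * π / 2)) := by
  have hs := intervalIntegral.hasSum_integral_of_dominated_convergence (μ := volume)
    (a := 0) (b := 2 * π)
    (F := fun (k : ℕ) u => q ^ (k + 1) * Real.cos ((k + 1 : ℕ) * u + β * π / 2) *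
      Real.cos (j * u - y)) (f := fun u => Pker q β u * Real.cos (j * u - y))
    (fun k _ => q ^ (k + 1))
    (fun k => (by fun_prop : Continuous _).aestronglyMeasurable)
    (fun k => Filter.Eventually.of_forall fun u _ => by
      have h0 : 0 ≤ q ^ (k + 1) := pow_nonneg hq.1.le _
      rw [Real.norm_eq_abs, abs_mul, abs_mul, abs_of_nonneg h0]
      have h1 := Real.abs_cos_le_one ((k + 1 : ℕ) * u + β * π / 2)
      have h2 := Real.abs_cos_le_one (j * u - y)
      calc _ ≤ q ^ (k + 1) * 1 * 1 := by gcongr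
        _ = _ := by ring)
    (Filter.Eventually.of_forall fun u _ => by
      exact (summable_nat_add_iff 1).2 (summable_geometric_of_lt_one hq.1.le hq.2))
    (by exact intervalIntegrable_const)
    (Filter.Eventually.of_forall fun u _ => by
      have := (Pker_hasSum hq β u).mul_right (Real.cos (j * u - y))
      rw [← Pker_eq hq] at this
      exact this)
  have e : ∀ k : ℕ, ∫ u in (0:ℝ)..(2 * π), q ^ (k + 1) * Real.cos ((k + 1 : ℕ) * u + β * π / 2) *
      Real.cos (j * u - y) = q ^ (k + 1) * 
        if j = k + 1 then π * Real.cos (β * π / 2 + y) else 0 := by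
    intro k
    rw [← orth, ← intervalIntegral.integral_const_mul]
    simp only [mul_assoc]
  simp_rw [e] at hs
  refine hs.unique ?_
  split_ifs with h
  · subst h
    have e0 : ∀ k : ℕ, q ^ (k + 1) * (if 0 = k + 1 then π * Real.cos (β * π / 2 + y) else 0) = 0 := by
      intro k
      rw [if_neg (by omega), mul_zero]
    simp_rw [e0]
    exact hasSum_zero
  · obtain ⟨i, rfl⟩ : ∃ i, j = i + 1 := ⟨j - 1, by omega⟩
    have := hasSum_single (f := fun k : ℕ => q ^ (k + 1) * 
        if i + 1 = k + 1 then π * Real.cos (β * π / 2 + y) else 0) i (by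
      intro k hk
      rw [if_neg (by omega), mul_zero])
    simp only [if_true] at this
    have e9 : π * (q ^ (i + 1) * Real.cos (y + β * π / 2)) =
        q ^ (i + 1) * (π * Real.cos (β * π / 2 + y)) := by
      rw [add_comm y]; ring
    rw [e9]; exact this

end
lemma swap_cont {F : ℝ → ℝ → ℝ} (hF : Continuous (Function.uncurry F)) (a b c d : ℝ) :
    ∫ x in a..b, ∫ y in c..d, F x y = ∫ y in c..d, ∫ x in a..b, F x y := by
  apply MeasureTheory.intervalIntegral_intervalIntegral_swap
  have : IntegrableOn (Function.uncurry F) (Set.uIcc a b ×ˢ Set.uIcc c d) volume :=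
    hF.continuousOn.integrableOn_compact (isCompact_uIcc.prod isCompact_uIcc)
  exact this.mono_set (Set.prod_mono Set.uIoc_subset_uIcc Set.uIoc_subset_uIcc)

lemma per_shift {g : ℝ → ℝ} (hg : Function.Periodic g (2 * π)) (x : ℝ) :
    ∫ t in (0:ℝ)..(2 * π), g (t + x) = ∫ t in (0:ℝ)..(2 * π), g t := by
  rw [intervalIntegral.integral_comp_add_right]
  have := hg.intervalIntegral_add_eq x 0
  rw [zero_add] at this ⊢
  rw [add_comm, this]

lemma cos_per (j : ℕ) (c : ℝ) : Function.Periodic (fun t => Real.cos (j * t + c)) (2 * π) := by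
  intro t
  have : (j:ℝ) * (t + 2 * π) + c = (j * t + c) + j * (2 * π) := by ring
  simp only [this]
  exact Real.cos_add_nat_mul_two_pi _ _

section

lemma f_cont {q : ℝ} (hq : q ∈ Set.Ioo (0:ℝ) 1) (β A₀ : ℝ) {φ : ℝ → ℝ} (hφ : Continuous φ) :
    Continuous fun x => A₀ + (1 / π) * ∫ t in (0:ℝ)..(2 * π), φ (x + t) * Pker q β t := by
  have hP := Pker_cont hq β
  have : Continuous fun x => ∫ t in (0:ℝ)..(2 * π), φ (x + t) * Pker q β t := by
    apply intervalIntegral.continuous_parametric_intervalIntegral_of_continuous'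
    unfold Function.uncurry
    fun_prop
  fun_prop

lemma f_coef {q : ℝ} (hq : q ∈ Set.Ioo (0:ℝ) 1) (β A₀ : ℝ) {φ : ℝ → ℝ} (hφ : Continuous φ) (hφp : Function.Periodic φ (2 * π))
    (j : ℕ) (y : ℝ) :
    ∫ t in (0:ℝ)..(2 * π), (A₀ + (1 / π) * ∫ u in (0:ℝ)..(2 * π), φ (t + u) * Pker q β u) *
      Real.cos (j * t - y) = A₀ * (∫ t in (0:ℝ)..(2 * π), Real.cos (j * t - y)) +
      if j = 0 then 0 else q ^ j * ∫ v in (0:ℝ)..(2 * π), φ v * Real.cos (j * v - y + β * π / 2) := by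
  have hP := Pker_cont hq β
  have hI : Continuous fun x => ∫ t in (0:ℝ)..(2 * π), φ (x + t) * Pker q β t := by
    apply intervalIntegral.continuous_parametric_intervalIntegral_of_continuous'
    unfold Function.uncurry
    fun_prop
  have e1 : ∀ t, (A₀ + (1 / π) * ∫ u in (0:ℝ)..(2 * π), φ (t + u) * Pker q β u) *
      Real.cos (j * t - y) = A₀ * Real.cos (j * t - y) +
      (1 / π) * ∫ u in (0:ℝ)..(2 * π), φ (t + u) * Pker q β u * Real.cos (j * t - y) := by
    intro t
    rw [intervalIntegral.integral_mul_const]; ring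
  have hI2 : Continuous fun t => ∫ u in (0:ℝ)..(2 * π), φ (t + u) * Pker q β u * Real.cos (j * t - y) := by
    apply intervalIntegral.continuous_parametric_intervalIntegral_of_continuous'
    unfold Function.uncurry
    fun_prop
  simp_rw [e1]
  rw [intervalIntegral.integral_add
    ((by fun_prop : Continuous _).intervalIntegrable _ _)
    ((by fun_prop : Continuous _).intervalIntegrable _ _),
    intervalIntegral.integral_const_mul, intervalIntegral.integral_const_mul,
    swap_cont (by unfold Function.uncurry; fun_prop)]
  congr 1
  have e2 : ∀ u, ∫ t in (0:ℝ)..(2 * π), φ (t + u) * Pker q β u * Real.cos (j * t - y) =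
      ∫ v in (0:ℝ)..(2 * π), φ v * Pker q β u * Real.cos (j * u - (j * v - y)) := by
    intro u
    rw [← per_shift (g := fun v => φ v * Pker q β u * Real.cos (j * u - (j * v - y))) _ u]
    · congr 1
      ext t
      congr 1
      rw [← Real.cos_neg]
      congr 1
      ring
    · have : Function.Periodic (fun v => Real.cos (j * v + (- j * u - y))) (2 * π) := cos_per _ _
      have e3 : (fun v => φ v * Pker q β u * Real.cos (j * u - (j * v - y))) =
          fun v => φ v * Pker q β u * Real.cos (j * v + (- j * u - y)) := by
        ext v
        congr 1
        rw [← Real.cos_neg]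
        congr 1
        ring
      rw [e3]
      intro v
      have h1 := this v
      have h2 := hφp v
      simp only at h1 ⊢
      rw [h1, h2]
  simp_rw [e2]
  rw [swap_cont (by unfold Function.uncurry; fun_prop)]
  simp_rw [mul_assoc, intervalIntegral.integral_const_mul, Pker_coef hq]
  split_ifs with h
  · simp
  · rw [← intervalIntegral.integral_const_mul, ← intervalIntegral.integral_const_mul]
    congr 1
    ext v
    field_simp

lemma dev_S {q : ℝ} (hq : q ∈ Set.Ioo (0:ℝ) 1) (β A₀ : ℝ) {φ : ℝ → ℝ} (hφ : Continuous φ) (hφp : Function.Periodic φ (2 * π))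
    (k : ℕ) (x : ℝ) :
    (A₀ + (1 / π) * ∫ t in (0:ℝ)..(2 * π), φ (x + t) * Pker q β t) -
    Ssum (fun x => A₀ + (1 / π) * ∫ t in (0:ℝ)..(2 * π), φ (x + t) * Pker q β t) k x =
      (1 / π) * ∫ t in (0:ℝ)..(2 * π), φ (x + t) * Rk q (β * π / 2) k t := by
  have hP := Pker_cont hq β
  have hf := f_cont hq β A₀ hφ
  have hpi := Real.pi_ne_zero
  have h0 := f_coef hq β A₀ hφ hφp 0 0
  have hj := f_coef hq β A₀ hφ hφp
  set f := fun x => A₀ + (1 / π) * ∫ t in (0:ℝ)..(2 * π), φ (x + t) * Pker q β t with hfdef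
  have c0 : coefA f 0 / 2 = A₀ := by
    unfold coefA
    simp only [CharP.cast_eq_zero, zero_mul, sub_zero, Real.cos_zero] at h0
    simp only [CharP.cast_eq_zero, zero_mul, Real.cos_zero, hfdef]
    rw [h0]
    simp
    field_simp
  have cj : ∀ j ∈ Finset.Icc 1 k, coefA f j * Real.cos (j * x) + coefB f j * Real.sin (j * x) =
      (1 / π) * ∫ t in (0:ℝ)..(2 * π), φ (x + t) * (q ^ j * Real.cos (j * t + β * π / 2)) := by
    intro j hj1
    have hj1 : j ≠ 0 := by have := (Finset.mem_Icc.1 hj1).1; omega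
    have e1 : coefA f j * Real.cos (j * x) + coefB f j * Real.sin (j * x) =
        (1 / π) * ∫ t in (0:ℝ)..(2 * π), f t * Real.cos (j * t - j * x) := by
      unfold coefA coefB
      have : ∀ t, f t * Real.cos (j * t - j * x) = f t * Real.cos (j * t) * Real.cos (j * x) +
          f t * Real.sin (j * t) * Real.sin (j * x) := by
        intro t; rw [Real.cos_sub]; ring
      simp_rw [this]
      rw [intervalIntegral.integral_add
        ((by fun_prop : Continuous _).intervalIntegrable _ _)
        ((by fun_prop : Continuous _).intervalIntegrable _ _),
        intervalIntegral.integral_mul_const, intervalIntegral.integral_mul_const]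
      ring
    rw [e1, hj j (j * x), if_neg hj1]
    have e2 : ∫ t in (0:ℝ)..(2 * π), Real.cos (j * t - j * x) = 0 := by
      have := int_cos_int (j : ℤ) (by exact_mod_cast hj1) (-(j * x))
      simpa [sub_eq_add_neg] using this
    rw [e2, mul_zero, zero_add]
    congr 1
    rw [← per_shift (g := fun v => φ v * Real.cos (j * v - j * x + β * π / 2)) _ x,
      ← intervalIntegral.integral_const_mul]
    · congr 1
      ext t
      have e3 : (j:ℝ) * (t + x) - j * x + β * π / 2 = j * t + β * π / 2 := by ring
      rw [e3, add_comm t x]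
      ring
    · have h1 := cos_per j (- (j * x) + β * π / 2)
      intro v
      have h2 := h1 v
      have h3 := hφp v
      have e4 : ∀ v : ℝ, (j:ℝ) * v - j * x + β * π / 2 = j * v + (- (j * x) + β * π / 2) := by
        intro v; ring
      simp only [e4] at h2 ⊢
      rw [h2, h3]
  unfold Ssum
  rw [c0, Finset.sum_congr rfl cj, ← Finset.mul_sum, ← intervalIntegral.integral_finsetSum]
  · have e5 : ∀ t, φ (x + t) * Rk q (β * π / 2) k t = φ (x + t) * Pker q β t -
        ∑ j ∈ Finset.Icc 1 k, φ (x + t) * (q ^ j * Real.cos (j * t + β * π / 2)) := by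
      intro t
      rw [Rk_eq_sub hq, ← Pker_eq hq, ← Finset.mul_sum]; ring
    simp_rw [e5]
    rw [intervalIntegral.integral_sub
        ((by fun_prop : Continuous _).intervalIntegrable _ _)
        ((by fun_prop : Continuous _).intervalIntegrable _ _)]
    ring
  · intro j _
    exact (by fun_prop : Continuous _).intervalIntegrable _ _

lemma sum_Rk {q : ℝ} (hq : q ∈ Set.Ioo (0:ℝ) 1) (γ : ℝ) {n p : ℕ} (hpn : p < n) (t : ℝ) :
    ∑ k ∈ Finset.Ico (n - p) n, Rk q γ k t = q ^ (n - p + 1) *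
      (Complex.exp ((((n - p + 1 : ℕ) * t + γ : ℝ) : ℂ) * Complex.I) * Gq p q t).re := by
  have h2 : 1 - zq q t ≠ 0 := Complex.slitPlane_ne_zero (slit1 hq t)
  have hz1 : zq q t ≠ 1 := fun h => h2 (by rw [h, sub_self])
  unfold Rk
  rw [← Complex.re_sum, ← Finset.mul_sum, ← Complex.re_ofReal_mul]
  congr 1
  have e1 : ∑ k ∈ Finset.Ico (n - p) n, zq q t ^ (k + 1) / (1 - zq q t) =
      zq q t ^ (n - p + 1) * Gq p q t := by
    simp_rw [pow_succ, mul_div_assoc]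
    rw [← Finset.sum_mul, geom_sum_Ico' hz1 (by omega), Gq]
    have : zq q t ^ n = zq q t ^ (n - p) * zq q t ^ p := by rw [← pow_add]; congr 1; omega
    rw [this]
    field_simp
  rw [e1]
  have e2 : zq q t ^ (n - p + 1) = ((q ^ (n - p + 1) : ℝ) : ℂ) *
      Complex.exp ((n - p + 1 : ℕ) * t * Complex.I) := by
    rw [zq, mul_pow, ← Complex.exp_nat_mul]
    push_cast
    ring_nf
  rw [e2, Complex.ofReal_add, add_mul, Complex.exp_add]
  push_cast
  ring

lemma dev_V {q : ℝ} (hq : q ∈ Set.Ioo (0:ℝ) 1) (β A₀ : ℝ) {φ : ℝ → ℝ} (hφ : Continuous φ) (hφp : Function.Periodic φ (2 * π))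
    {n p : ℕ} (hpn : p < n) (hp : 0 < p) (x : ℝ) :
    (A₀ + (1 / π) * ∫ t in (0:ℝ)..(2 * π), φ (x + t) * Pker q β t) -
    Vsum n p (fun x => A₀ + (1 / π) * ∫ t in (0:ℝ)..(2 * π), φ (x + t) * Pker q β t) x =
      q ^ (n - p + 1) / p * (1 / π) * ∫ t in (0:ℝ)..(2 * π), φ (x + t) *
        (‖Gq p q t‖ * Real.cos ((n - p + 1 : ℕ) * t + β * π / 2 + (Lam p q t).im)) := by
  have hS := dev_S hq β A₀ hφ hφp
  set f := fun x => A₀ + (1 / π) * ∫ t in (0:ℝ)..(2 * π), φ (x + t) * Pker q β t with hfdef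
  have hp' : (p:ℝ) ≠ 0 := by exact_mod_cast hp.ne'
  have e1 : f x - Vsum n p f x = (1 / (p:ℝ)) * ∑ k ∈ Finset.Ico (n - p) n, (f x - Ssum f k x) := by
    rw [Vsum, Finset.sum_sub_distrib, Finset.sum_const, Nat.card_Ico,
      show n - (n - p) = p by omega, nsmul_eq_mul]
    field_simp
  have e2 : ∀ k, f x - Ssum f k x =
      (1 / π) * ∫ t in (0:ℝ)..(2 * π), φ (x + t) * Rk q (β * π / 2) k t := fun k => hS k x
  have hR := fun k => Rk_cont hq (β * π / 2) k
  change f x - Vsum n p f x = _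
  rw [e1]
  simp_rw [e2]
  rw [← Finset.mul_sum, ← intervalIntegral.integral_finsetSum]
  · simp_rw [← Finset.mul_sum, sum_Rk hq _ hpn, re_kernel hq hp]
    have : ∀ t, φ (x + t) * (q ^ (n - p + 1) * (‖Gq p q t‖ * Real.cos ((n - p + 1 : ℕ) * t +
        β * π / 2 + (Lam p q t).im))) = q ^ (n - p + 1) * (φ (x + t) * (‖Gq p q t‖ *
          Real.cos ((n - p + 1 : ℕ) * t + β * π / 2 + (Lam p q t).im))) := by
      intro t; ring
    simp_rw [this]
    rw [intervalIntegral.integral_const_mul]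
    ring
  · intro k _
    have := hR k
    exact (by fun_prop : Continuous _).intervalIntegrable _ _

/-- the kernel has mean zero -/
lemma ker_mean {q : ℝ} (hq : q ∈ Set.Ioo (0:ℝ) 1) (β : ℝ) {n p : ℕ} (hpn : p < n) (hp : 0 < p) :
    ∫ t in (0:ℝ)..(2 * π),
        (‖Gq p q t‖ * Real.cos ((n - p + 1 : ℕ) * t + β * π / 2 + (Lam p q t).im)) = 0 := by
  have hR := fun k => Rk_cont hq (β * π / 2) k
  have hP := Pker_cont hq β
  have hRk : ∀ k, ∫ t in (0:ℝ)..(2 * π), Rk q (β * π / 2) k t = 0 := by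
    intro k
    simp_rw [Rk_eq_sub hq _ k, ← Pker_eq hq]
    rw [intervalIntegral.integral_sub
        ((by fun_prop : Continuous _).intervalIntegrable _ _)
        ((by fun_prop : Continuous _).intervalIntegrable _ _),
        intervalIntegral.integral_finsetSum
        (fun _ _ => (by fun_prop : Continuous _).intervalIntegrable _ _)]
    have a1 := Pker_coef hq β 0 0
    simp at a1
    rw [a1, Finset.sum_eq_zero, sub_zero]
    intro j hj
    have hj1 : j ≠ 0 := by have := (Finset.mem_Icc.1 hj).1; omega
    rw [intervalIntegral.integral_const_mul]
    have := int_cos_int (j : ℤ) (by exact_mod_cast hj1) (β * π / 2)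
    simp only [Int.cast_natCast] at this
    rw [this, mul_zero]
  have hsum : ∫ t in (0:ℝ)..(2 * π), ∑ k ∈ Finset.Ico (n - p) n, Rk q (β * π / 2) k t = 0 := by
    rw [intervalIntegral.integral_finsetSum
        (fun k _ => (hR k).intervalIntegrable _ _)]
    exact Finset.sum_eq_zero fun k _ => hRk k
  simp_rw [sum_Rk hq _ hpn, re_kernel hq hp] at hsum
  rw [intervalIntegral.integral_const_mul] at hsum
  have := pow_pos hq.1 (n - p + 1)
  exact (mul_eq_zero.1 hsum).resolve_left this.ne'

end

lemma delta_pow {q : ℝ} (hq : q ∈ Set.Ioo (0:ℝ) 1) (p : ℕ) :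
    2 / (1 - q) ^ (δp p - 1) * (3 / (1 - q)) = 6 / (1 - q) ^ δp p := by
  have h1 : (1 - q) ≠ 0 := by have := hq.2; linarith
  have h2 : δp p = (δp p - 1) + 1 := by unfold δp; split_ifs <;> rfl
  have h3 : (1 - q) ^ δp p = (1 - q) ^ (δp p - 1) * (1 - q) := by
    conv_lhs => rw [h2, pow_succ]
  rw [h3, div_mul_div_comm]
  norm_num

lemma zero_mem_Hclass {ω : ℝ → ℝ} (hω : IsConcaveModulus ω) : (fun _ => (0:ℝ)) ∈ Hclass ω := by
  refine ⟨continuous_const, fun _ => rfl, fun s t => ?_⟩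
  simp only [sub_self, abs_zero]
  have := hω.1.2.1 (Set.mem_Ici.2 le_rfl) (Set.mem_Ici.2 (abs_nonneg (s - t))) (abs_nonneg (s - t))
  rw [hω.1.2.2.2] at this
  exact this

lemma const_mem_CqbH {ω : ℝ → ℝ} (hω : IsConcaveModulus ω) (q β c : ℝ) :
    (fun _ => c) ∈ CqbH q β ω := by
  refine ⟨c, _, zero_mem_Hclass hω, ?_⟩
  funext x
  simp

lemma Edev_p_zero {ω : ℝ → ℝ} (hω : IsConcaveModulus ω) (q β : ℝ) (n : ℕ) :
    Edev (CqbH q β ω) (Vsum n 0) = 0 := by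
  unfold Edev
  apply Real.iSup_of_not_bddAbove
  rintro ⟨B, hB⟩
  have h := hB ⟨⟨_, const_mem_CqbH hω q β (|B| + 1)⟩, rfl⟩
  simp only [Vsum, Nat.cast_zero, div_zero, zero_mul, sub_zero, ciSup_const] at h
  rw [abs_of_nonneg (by positivity)] at h
  linarith [le_abs_self B]

lemma dev_upper {q β : ℝ} (hq : q ∈ Set.Ioo (0:ℝ) 1) {n p : ℕ} (hpn : p < n) (hp : 0 < p)
    {ω : ℝ → ℝ} (hω : IsConcaveModulus ω)
    (hm : 6 / (1 - q) ≤ ((n - p + 1 : ℕ) : ℝ)) {f : ℝ → ℝ} (hf : f ∈ CqbH q β ω) (x : ℝ) :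
    |f x - Vsum n p f x| ≤ q ^ (n - p + 1) / (p : ℝ) * (1 / π) *
      (Kpq p q * eInt (n - p + 1) ω / π +
        100 * (2 / (1 - q) ^ (δp p - 1) * (3 / (1 - q)) * ω π / (n - p + 1 : ℕ))) := by
  obtain ⟨A₀, φ, hφ, rfl⟩ := hf
  have hph := ph_main hq hp hm (β * π / 2) (G_bound hq p)
  have hψ : (fun t => φ (x + t) - φ x) ∈ Hclass ω := by
    refine ⟨?_, fun t => ?_, fun s t => ?_⟩
    · have := hφ.1
      fun_prop
    · show φ (x + (t + 2 * π)) - φ x = φ (x + t) - φ x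
      rw [← add_assoc, hφ.2.1]
    · have := hφ.2.2 (x + s) (x + t)
      rw [show φ (x + s) - φ x - (φ (x + t) - φ x) = φ (x + s) - φ (x + t) by ring]
      rw [show x + s - (x + t) = s - t by ring] at this
      exact this
  have hU := hph.upper_bound hω hψ (fun t => osc_le hω hφ _ _)
  have hd := dev_V hq β A₀ hφ.1 hφ.2.1 hpn hp x
  have hk := ker_mean hq β hpn hp
  have c1 := hph.rc
  have c2 := hph.cont
  have c3 := hφ.1
  have h_int_eq : ∫ t in (0:ℝ)..(2 * π), φ (x + t) * (‖Gq p q t‖ *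
        Real.cos ((n - p + 1 : ℕ) * t + β * π / 2 + (Lam p q t).im)) =
      ∫ t in (0:ℝ)..(2 * π), (φ (x + t) - φ x) * (‖Gq p q t‖ *
        Real.cos ((n - p + 1 : ℕ) * t + β * π / 2 + (Lam p q t).im)) := by
    have ck : Continuous fun t => ‖Gq p q t‖ *
        Real.cos ((n - p + 1 : ℕ) * t + β * π / 2 + (Lam p q t).im) :=
      c1.mul (Real.continuous_cos.comp c2)
    simp_rw [sub_mul]
    rw [intervalIntegral.integral_sub, intervalIntegral.integral_const_mul, hk]
    · ring
    · exact Continuous.intervalIntegrable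
        ((c3.comp (continuous_const.add continuous_id)).mul ck) _ _
    · exact Continuous.intervalIntegrable (continuous_const.mul ck) _ _
  show |(A₀ + (1 / π) * ∫ t in (0:ℝ)..(2 * π), φ (x + t) * Pker q β t) - _| ≤ _
  rw [hd, h_int_eq, abs_mul, Kpq_eq]
  have h0 : 0 ≤ q ^ (n - p + 1) / (p : ℝ) * (1 / π) := by
    have := hq.1
    have := Real.pi_pos
    positivity
  rw [abs_of_nonneg h0]
  exact mul_le_mul_of_nonneg_left hU h0

lemma dev_lower {q β : ℝ} (hq : q ∈ Set.Ioo (0:ℝ) 1) {n p : ℕ} (hpn : p < n) (hp : 0 < p)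
    {ω : ℝ → ℝ} (hω : IsConcaveModulus ω)
    (hm : 6 / (1 - q) ≤ ((n - p + 1 : ℕ) : ℝ)) :
    ∃ f ∈ CqbH q β ω, q ^ (n - p + 1) / (p : ℝ) * (1 / π) *
      (Kpq p q * eInt (n - p + 1) ω / π -
        100 * (2 / (1 - q) ^ (δp p - 1) * (3 / (1 - q)) * ω π / (n - p + 1 : ℕ))) ≤
      |f 0 - Vsum n p f 0| := by
  have hph := ph_main hq hp hm (β * π / 2) (G_bound hq p)
  obtain ⟨φ, hφ, hL⟩ := hph.lower_bound hω
  refine ⟨_, ⟨0, φ, hφ, rfl⟩, ?_⟩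
  have hd := dev_V hq β 0 hφ.1 hφ.2.1 hpn hp 0
  refine le_trans ?_ (le_abs_self _)
  refine le_trans ?_ (le_of_eq hd.symm)
  have h0 : 0 ≤ q ^ (n - p + 1) / (p : ℝ) * (1 / π) := by
    have := hq.1
    have := Real.pi_pos
    positivity
  rw [Kpq_eq]
  refine mul_le_mul_of_nonneg_left ?_ h0
  simp only [zero_add]
  exact hL

/-- **Theorem 1** (Serdyuk–Ovsii): asymptotic formula for
`E(C^q_β H_ω; V_{n,p})` with explicit remainder bound. -/
theorem vallee_poussin_Homega :
    ∃ C : ℝ, 0 < C ∧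
      ∀ (q β : ℝ) (n p : ℕ) (ω : ℝ → ℝ),
        q ∈ Set.Ioo (0:ℝ) 1 → p < n → IsConcaveModulus ω →
        6 / (1 - q) ≤ (n : ℝ) - (p : ℝ) →
        |Edev (CqbH q β ω) (Vsum n p) -
            q ^ (n - p + 1) / (p : ℝ) * (Kpq p q / π ^ 2) * eInt (n - p + 1) ω| ≤
          C * (q ^ (n - p + 1) / (p : ℝ)) * ω π /
            ((1 - q) ^ δp p * ((n - p + 1 : ℕ) : ℝ)) := by

  refine ⟨600, by norm_num, ?_⟩
  intro q β n p ω hq hpn hω hm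
  rcases Nat.eq_zero_or_pos p with rfl | hp
  · rw [Edev_p_zero hω]
    simp
  have hm' : 6 / (1 - q) ≤ ((n - p + 1 : ℕ) : ℝ) := by
    push_cast [Nat.cast_sub hpn.le]
    linarith
  have hU := fun f (hf : f ∈ CqbH q β ω) x => dev_upper hq hpn hp hω hm' hf x
  obtain ⟨f₀, hf₀, hL⟩ := dev_lower (β := β) hq hpn hp hω hm'
  rw [delta_pow hq] at hL
  simp_rw [delta_pow hq] at hU
  set Q := q ^ (n - p + 1) / (p : ℝ) with hQ
  set err := 6 / (1 - q) ^ δp p * ω π / ((n - p + 1 : ℕ) : ℝ) with herr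
  have hQ0 : 0 ≤ Q := by
    have := hq.1
    positivity
  have hpi := Real.pi_gt_three
  have h1q : 0 < 1 - q := by have := hq.2; linarith
  have hωπ : 0 ≤ ω π := om_nonneg hω Real.pi_pos.le
  have herr0 : 0 ≤ err := by positivity
  have hE1 : Edev (CqbH q β ω) (Vsum n p) ≤
      Q * (1 / π) * (Kpq p q * eInt (n - p + 1) ω / π + 100 * err) := by
    unfold Edev
    have : Nonempty (CqbH q β ω) := ⟨⟨f₀, hf₀⟩⟩
    exact ciSup_le fun f => ciSup_le fun x => hU f.1 f.2 x
  have hE2 : Q * (1 / π) * (Kpq p q * eInt (n - p + 1) ω / π - 100 * err) ≤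
      Edev (CqbH q β ω) (Vsum n p) := by
    refine hL.trans ?_
    unfold Edev
    refine le_trans ?_ (le_ciSup (f := fun f : CqbH q β ω =>
      ⨆ x : ℝ, |(f : ℝ → ℝ) x - Vsum n p f x|) ?_ ⟨f₀, hf₀⟩)
    · refine le_ciSup (f := fun x : ℝ => |f₀ x - Vsum n p f₀ x|) ?_ 0
      refine ⟨Q * (1 / π) * (Kpq p q * eInt (n - p + 1) ω / π + 100 * err), ?_⟩
      rintro _ ⟨x, rfl⟩
      exact hU f₀ hf₀ x
    · refine ⟨Q * (1 / π) * (Kpq p q * eInt (n - p + 1) ω / π + 100 * err), ?_⟩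
      rintro _ ⟨f, rfl⟩
      exact ciSup_le fun x => hU f.1 f.2 x
  have e1 : Q * (1 / π) * (Kpq p q * eInt (n - p + 1) ω / π) =
      Q * (Kpq p q / π ^ 2) * eInt (n - p + 1) ω := by
    field_simp
  have e2 : 600 * Q * ω π / ((1 - q) ^ δp p * ((n - p + 1 : ℕ) : ℝ)) = Q * (100 * err) := by
    rw [herr]
    generalize Q = Q'
    simp only [div_eq_mul_inv, mul_inv]
    ring
  have e3 : Q * (1 / π) * (100 * err) ≤ Q * (100 * err) := by
    have : 1 / π ≤ 1 := by
      rw [div_le_one Real.pi_pos]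
      linarith
    have h3 : Q * (1 / π) ≤ Q := mul_le_of_le_one_right hQ0 this
    exact mul_le_mul_of_nonneg_right h3 (by positivity)
  rw [e2, ← e1, abs_le]
  rw [mul_add] at hE1
  rw [mul_sub] at hE2
  constructor <;> linarith
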